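/- Let u be a viscosity solution of λ (det D²u)^p ≤ u_t ≤ Λ (det D²u)^p in Ω × [0,T], continuous on Ω̄ × [0,T], with u(·,0) ≥ 0 on Ω and u(·,0) ≥ 1 on ∂Ω. Then there exists α > 0 depending only on n, λ, Λ, p such that: (a) for every t ∈ (0,T] and every x in the interior of the set {y ∈ Ω : u(y,0) = 0} with u(x,t) < 1, the function u(·,t) is C^{1,α} at x (with some finite constant); (b) if moreover u(x,0) ≥ |x·e_n| for all x ∈ Ω, then for every t ∈ (0,T] and every point x = (x′,0) such that x′ is an interior point in ℝ^{n−1} of the set {y′ : (y′,0) ∈ Ω and u((y′,0),0) = 0} and u(x,t) < 1, the restriction y′ ↦ u((y′,0),t) is C^{1,α} at x′. -/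

import Mathlib

open Set Metric MeasureTheory
open scoped RealInnerProductSpace

noncomputable section

abbrev E (n : ℕ) := EuclideanSpace ℝ (Fin n)

variable {n : ℕ}

/-- The time derivative `∂ₜφ(x,t)`. -/
noncomputable def timeDeriv (φ : E n → ℝ → ℝ) (x : E n) (t : ℝ) : ℝ :=
  deriv (φ x) t

/-- The spatial Hessian matrix `D²φ(x,t)` (in the standard coordinates). -/
noncomputable def hessMatrix (φ : E n → ℝ → ℝ) (x : E n) (t : ℝ) :
    Matrix (Fin n) (Fin n) ℝ :=
  Matrix.of fun i j =>
    fderiv ℝ (fun y => fderiv ℝ (fun z => φ z t) y (EuclideanSpace.single j (1:ℝ))) x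
      (EuclideanSpace.single i (1:ℝ))

/-- `φ` is an admissible test function near `(x₀,t₀)`: C² in `x` and C¹ in `t` nearby. -/
def IsTestAt (φ : E n → ℝ → ℝ) (x₀ : E n) (t₀ : ℝ) : Prop :=
  ∃ ε > (0:ℝ),
    (∀ t ∈ ball t₀ ε, ContDiffOn ℝ 2 (fun x => φ x t) (ball x₀ ε)) ∧
    (∀ x ∈ ball x₀ ε, ContDiffOn ℝ 1 (fun t => φ x t) (ball t₀ ε))

/-- `u - φ` attains a local maximum at `(x₀,t₀)` among times `t ≤ t₀`,
relative to `closure Ω × [t₁,t₂]`. -/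
def LocalMaxBelow (Ω : Set (E n)) (t₁ t₂ : ℝ) (u φ : E n → ℝ → ℝ)
    (x₀ : E n) (t₀ : ℝ) : Prop :=
  ∃ ε > (0:ℝ), ∀ x ∈ closure Ω, ∀ t ∈ Icc t₁ t₂, t ≤ t₀ →
    dist x x₀ < ε → dist t t₀ < ε →
    u x t - φ x t ≤ u x₀ t₀ - φ x₀ t₀

/-- `u - φ` attains a local minimum at `(x₀,t₀)` among times `t ≤ t₀`. -/
def LocalMinBelow (Ω : Set (E n)) (t₁ t₂ : ℝ) (u φ : E n → ℝ → ℝ)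
    (x₀ : E n) (t₀ : ℝ) : Prop :=
  ∃ ε > (0:ℝ), ∀ x ∈ closure Ω, ∀ t ∈ Icc t₁ t₂, t ≤ t₀ →
    dist x x₀ < ε → dist t t₀ < ε →
    u x₀ t₀ - φ x₀ t₀ ≤ u x t - φ x t

/-- Viscosity subsolution of `u_t ≤ Λ (det D²u)^p` on `Ω × [t₁,t₂]`. -/
def ViscSubsolution (Lam p : ℝ) (Ω : Set (E n)) (t₁ t₂ : ℝ) (u : E n → ℝ → ℝ) : Prop :=
  ∀ x₀ ∈ Ω, ∀ t₀ ∈ Ioc t₁ t₂, ∀ φ : E n → ℝ → ℝ, IsTestAt φ x₀ t₀ →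
    LocalMaxBelow Ω t₁ t₂ u φ x₀ t₀ →
    timeDeriv φ x₀ t₀ ≤ Lam * max (hessMatrix φ x₀ t₀).det 0 ^ p

/-- Viscosity supersolution of `u_t ≥ λ (det D²u)^p` on `Ω × [t₁,t₂]`. -/
def ViscSupersolution (lam p : ℝ) (Ω : Set (E n)) (t₁ t₂ : ℝ) (u : E n → ℝ → ℝ) : Prop :=
  ∀ x₀ ∈ Ω, ∀ t₀ ∈ Ioc t₁ t₂, ∀ φ : E n → ℝ → ℝ, IsTestAt φ x₀ t₀ →
    LocalMinBelow Ω t₁ t₂ u φ x₀ t₀ →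
    (hessMatrix φ x₀ t₀).PosSemidef →
    lam * (hessMatrix φ x₀ t₀).det ^ p ≤ timeDeriv φ x₀ t₀

/-- The regularity/structure assumptions: continuity on `closure Ω × [t₁,t₂]`,
convexity in `x`, monotonicity in `t`. -/
structure ParabolicRegular (Ω : Set (E n)) (t₁ t₂ : ℝ) (u : E n → ℝ → ℝ) : Prop where
  cont : ContinuousOn (fun q : E n × ℝ => u q.1 q.2) (closure Ω ×ˢ Icc t₁ t₂)
  conv : ∀ t ∈ Icc t₁ t₂, ConvexOn ℝ (closure Ω) (fun x => u x t)
  mono : ∀ x ∈ closure Ω, ∀ s ∈ Icc t₁ t₂, ∀ t ∈ Icc t₁ t₂, s ≤ t → u x s ≤ u x t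

/-- Viscosity solution of `λ (det D²u)^p ≤ u_t ≤ Λ (det D²u)^p` on `Ω × [t₁,t₂]`. -/
def ViscositySolution (lam Lam p : ℝ) (Ω : Set (E n)) (t₁ t₂ : ℝ) (u : E n → ℝ → ℝ) : Prop :=
  ParabolicRegular Ω t₁ t₂ u ∧ ViscSubsolution Lam p Ω t₁ t₂ u ∧
    ViscSupersolution lam p Ω t₁ t₂ u

/-- `w` is `C^{1,α}` at `x₀` (relative to the set `D`) with some finite constant. -/
def C1AlphaAt (w : E n → ℝ) (D : Set (E n)) (α : ℝ) (x₀ : E n) : Prop :=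
  ∃ C a : ℝ, ∃ q : E n, ∀ x ∈ D, |w x - (a + ⟪q, x - x₀⟫)| ≤ C * ‖x - x₀‖ ^ (1 + α)

/-- `w` is `C^{1,α}` at `x₀` in the direction `e` (relative to the set `D`). -/
def C1AlphaDirAt (w : E n → ℝ) (D : Set (E n)) (α : ℝ) (x₀ e : E n) : Prop :=
  ∃ C a q : ℝ, ∀ s : ℝ, x₀ + s • e ∈ D →
    |w (x₀ + s • e) - (a + q * s)| ≤ C * |s| ^ (1 + α)

/-- A convex set `S` is `d`-balanced with respect to `x₀`. -/
def DBalanced (d : ℝ) (S : Set (E n)) (x₀ : E n) : Prop :=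
  ∃ A : E n →ₗ[ℝ] E n, Function.Bijective A ∧
    ball (0 : E n) 1 ⊆ A '' ((fun y => y - x₀) '' S) ∧
    A '' ((fun y => y - x₀) '' S) ⊆ ball (0 : E n) d

/-- `x₀` is an extremal point of the convex set `D`. -/
def ExtremalPoint (D : Set (E n)) (x₀ : E n) : Prop :=
  ¬ ∃ y ∈ closure D, ∃ z ∈ closure D, ∃ t : ℝ,
      0 < t ∧ t < 1 ∧ y ≠ z ∧ x₀ = t • y + (1 - t) • z

/-- Embedding of `ℝ^{n-1}` into `ℝⁿ` as the slice `{xₙ = 0}`. -/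
noncomputable def embSlice (n : ℕ) (x' : E (n-1)) : E n :=
  (EuclideanSpace.equiv (Fin n) ℝ).symm fun i => if h : (i : ℕ) < n - 1 then x' ⟨i, h⟩ else 0

/-- The paraboloid `c + ℓ(x) + k |A (x - z)|² + r (t - t₁)`. -/
def paraboloid (c k r t₁ : ℝ) (ℓ : E n →L[ℝ] ℝ) (A : E n →L[ℝ] E n) (z : E n) :
    E n → ℝ → ℝ :=
  fun x t => c + ℓ x + k * ‖A (x - z)‖ ^ 2 + r * (t - t₁)

section
variable (c k r t₁ : ℝ) (ℓ : E n →L[ℝ] ℝ) (A : E n →L[ℝ] E n) (z : E n)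

lemma isTestAt_paraboloid (x₀ : E n) (t₀ : ℝ) :
    IsTestAt (paraboloid c k r t₁ ℓ A z) x₀ t₀ := by
  refine ⟨1, one_pos, fun t _ => ?_, fun x _ => ?_⟩
  · apply ContDiff.contDiffOn
    unfold paraboloid
    have h : ContDiff ℝ 2 (fun x : E n => ‖A (x - z)‖ ^ 2) :=
      (A.contDiff.comp (contDiff_id.sub contDiff_const)).norm_sq ℝ
    exact ((contDiff_const.add ℓ.contDiff).add (contDiff_const.mul h)).add contDiff_const
  · apply ContDiff.contDiffOn
    unfold paraboloid
    fun_prop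

lemma timeDeriv_paraboloid (x₀ : E n) (t₀ : ℝ) :
    timeDeriv (paraboloid c k r t₁ ℓ A z) x₀ t₀ = r := by
  have h : HasDerivAt (fun t => paraboloid c k r t₁ ℓ A z x₀ t) (r * 1) t₀ := by
    unfold paraboloid
    exact (((hasDerivAt_id t₀).sub_const t₁).const_mul r).const_add _
  simpa [timeDeriv] using h.deriv

lemma hessMatrix_paraboloid (x₀ : E n) (t₀ : ℝ) :
    hessMatrix (paraboloid c k r t₁ ℓ A z) x₀ t₀ =
      (2 * k) • ((Matrix.of fun i j => A (EuclideanSpace.single j (1:ℝ)) i).transpose *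
        (Matrix.of fun i j => A (EuclideanSpace.single j (1:ℝ)) i)) := by
  have h1 : ∀ y v : E n, fderiv ℝ (fun x => paraboloid c k r t₁ ℓ A z x t₀) y v =
      ℓ v + k * (2 * ⟪A (y - z), A v⟫) := by
    intro y v
    have hs : HasFDerivAt (fun x : E n => ‖A (x - z)‖ ^ 2) _ y :=
      (A.hasFDerivAt.comp y ((hasFDerivAt_id y).sub_const z)).norm_sq
    have h : HasFDerivAt (fun x => paraboloid c k r t₁ ℓ A z x t₀) _ y :=
      ((ℓ.hasFDerivAt.const_add c).add (hs.const_mul k)).add_const _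
    rw [h.fderiv]
    simp [inner_sub_left]
  ext i j
  simp only [hessMatrix, h1, Matrix.of_apply, Matrix.smul_apply, Matrix.mul_apply,
    Matrix.transpose_apply, smul_eq_mul]
  have h2 : HasFDerivAt (fun y : E n => ℓ (EuclideanSpace.single j (1:ℝ)) +
      k * (2 * ⟪A (y - z), A (EuclideanSpace.single j (1:ℝ))⟫)) _ x₀ :=
    ((((A.hasFDerivAt.comp x₀ ((hasFDerivAt_id x₀).sub_const z)).inner ℝ
      (hasFDerivAt_const _ _)).const_mul 2).const_mul k).const_add _
  rw [h2.fderiv]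
  simp only [smul_apply, smul_eq_mul, ContinuousLinearMap.comp_apply,
    ContinuousLinearMap.prod_apply, zero_apply, fderivInnerCLM_apply,
    inner_zero_right, ContinuousLinearMap.id_apply, zero_add]
  rw [PiLp.inner_apply]
  simp [mul_assoc, mul_comm]

lemma det_hessMatrix_paraboloid (x₀ : E n) (t₀ : ℝ) :
    (hessMatrix (paraboloid c k r t₁ ℓ A z) x₀ t₀).det =
      (2 * k) ^ n * LinearMap.det (A : E n →ₗ[ℝ] E n) ^ 2 := by
  have h : LinearMap.toMatrix (EuclideanSpace.basisFun (Fin n) ℝ).toBasis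
      (EuclideanSpace.basisFun (Fin n) ℝ).toBasis (A : E n →ₗ[ℝ] E n) =
      Matrix.of fun i j => A (EuclideanSpace.single j (1:ℝ)) i := by
    ext i j
    simp [LinearMap.toMatrix_apply]
  rw [hessMatrix_paraboloid, Matrix.det_smul, Matrix.det_mul, Matrix.det_transpose, ← h,
    LinearMap.det_toMatrix]
  simp [sq]

lemma posSemidef_hessMatrix_paraboloid (hk : 0 ≤ k) (x₀ : E n) (t₀ : ℝ) :
    (hessMatrix (paraboloid c k r t₁ ℓ A z) x₀ t₀).PosSemidef := by
  rw [hessMatrix_paraboloid]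
  refine Matrix.PosSemidef.smul ?_ (by positivity)
  simpa using Matrix.posSemidef_conjTranspose_mul_self
    (Matrix.of fun i j => A (EuclideanSpace.single j (1:ℝ)) i)

lemma continuous_paraboloid :
    Continuous fun q : E n × ℝ => paraboloid c k r t₁ ℓ A z q.1 q.2 := by
  unfold paraboloid
  fun_prop

end

/-- Comparison of a subsolution with a strict paraboloid supersolution. -/
lemma le_paraboloid_of_subsolution {Ω : Set (E n)} {T Lam p : ℝ} {u : E n → ℝ → ℝ}
    (hreg : ParabolicRegular Ω 0 T u) (hsub : ViscSubsolution Lam p Ω 0 T u)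
    {c k r t₁ t₂ : ℝ} {ℓ : E n →L[ℝ] ℝ} {A : E n →L[ℝ] E n} {z : E n}
    {K U : Set (E n)} (hK : IsCompact K) (hU : IsOpen U) (hUK : U ⊆ K) (hKΩ : K ⊆ Ω)
    (ht₁ : 0 ≤ t₁) (ht₂ : t₂ ≤ T) (hk : 0 ≤ k)
    (hr : Lam * ((2 * k) ^ n * LinearMap.det (A : E n →ₗ[ℝ] E n) ^ 2) ^ p < r)
    (hinit : ∀ x ∈ K, u x t₁ ≤ paraboloid c k r t₁ ℓ A z x t₁)
    (hlat : ∀ x ∈ K, x ∉ U → ∀ t ∈ Icc t₁ t₂, u x t ≤ paraboloid c k r t₁ ℓ A z x t) :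
    ∀ x ∈ K, ∀ t ∈ Icc t₁ t₂, u x t ≤ paraboloid c k r t₁ ℓ A z x t := by
  by_contra! hcon
  obtain ⟨x₁, hx₁, s₁, hs₁, hlt⟩ := hcon
  have hsubset : K ×ˢ Icc t₁ t₂ ⊆ closure Ω ×ˢ Icc 0 T :=
    prod_mono (hKΩ.trans subset_closure) (Icc_subset_Icc ht₁ ht₂)
  obtain ⟨⟨x₀, t₀⟩, ⟨hx₀, ht₀⟩, hmax⟩ := (hK.prod isCompact_Icc).exists_isMaxOn
    (f := fun q : E n × ℝ => u q.1 q.2 - paraboloid c k r t₁ ℓ A z q.1 q.2)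
    ⟨(x₁, s₁), hx₁, hs₁⟩
    ((hreg.cont.mono hsubset).sub (continuous_paraboloid c k r t₁ ℓ A z).continuousOn)
  simp only at hx₀ ht₀
  have hpos : paraboloid c k r t₁ ℓ A z x₀ t₀ < u x₀ t₀ := by
    have := hmax (show (x₁, s₁) ∈ K ×ˢ Icc t₁ t₂ from ⟨hx₁, hs₁⟩)
    simp only [mem_ofPred_eq] at this
    linarith
  have hx₀U : x₀ ∈ U := by
    by_contra h
    exact (hlat x₀ hx₀ h t₀ ht₀).not_gt hpos
  have ht₀₁ : t₁ < t₀ := by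
    rcases ht₀.1.lt_or_eq with h | h
    · exact h
    · subst h
      exact absurd (hinit x₀ hx₀) hpos.not_ge
  obtain ⟨ε, hε, hball⟩ := Metric.isOpen_iff.1 hU x₀ hx₀U
  have := hsub x₀ (hKΩ hx₀) t₀ ⟨ht₁.trans_lt ht₀₁, ht₀.2.trans ht₂⟩
    (paraboloid c k r t₁ ℓ A z) (isTestAt_paraboloid ..)
    ⟨min ε (t₀ - t₁), lt_min hε (by linarith), fun x _ t _ htt₀ hx ht => by
      have hxK : x ∈ K := hUK (hball (hx.trans_le (min_le_left _ _)))
      have ht' : t₁ ≤ t := by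
        have := ht.trans_le (min_le_right _ _)
        rw [Real.dist_eq, abs_lt] at this
        linarith
      exact hmax (show (x, t) ∈ K ×ˢ Icc t₁ t₂ from ⟨hxK, ht', htt₀.trans ht₀.2⟩)⟩
  rw [timeDeriv_paraboloid, det_hessMatrix_paraboloid, max_eq_left (by positivity)] at this
  linarith

/-- Comparison of a supersolution with a strict paraboloid subsolution. -/
lemma paraboloid_le_of_supersolution {Ω : Set (E n)} {T lam p : ℝ} {u : E n → ℝ → ℝ}
    (hreg : ParabolicRegular Ω 0 T u) (hsup : ViscSupersolution lam p Ω 0 T u)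
    {c k r t₁ t₂ : ℝ} {ℓ : E n →L[ℝ] ℝ} {A : E n →L[ℝ] E n} {z : E n}
    {K U : Set (E n)} (hK : IsCompact K) (hU : IsOpen U) (hUK : U ⊆ K) (hKΩ : K ⊆ Ω)
    (ht₁ : 0 ≤ t₁) (ht₂ : t₂ ≤ T) (hk : 0 ≤ k)
    (hr : r < lam * ((2 * k) ^ n * LinearMap.det (A : E n →ₗ[ℝ] E n) ^ 2) ^ p)
    (hinit : ∀ x ∈ K, paraboloid c k r t₁ ℓ A z x t₁ ≤ u x t₁)
    (hlat : ∀ x ∈ K, x ∉ U → ∀ t ∈ Icc t₁ t₂, paraboloid c k r t₁ ℓ A z x t ≤ u x t) :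
    ∀ x ∈ K, ∀ t ∈ Icc t₁ t₂, paraboloid c k r t₁ ℓ A z x t ≤ u x t := by
  by_contra! hcon
  obtain ⟨x₁, hx₁, s₁, hs₁, hlt⟩ := hcon
  have hsubset : K ×ˢ Icc t₁ t₂ ⊆ closure Ω ×ˢ Icc 0 T :=
    prod_mono (hKΩ.trans subset_closure) (Icc_subset_Icc ht₁ ht₂)
  obtain ⟨⟨x₀, t₀⟩, ⟨hx₀, ht₀⟩, hmin⟩ := (hK.prod isCompact_Icc).exists_isMinOn
    (f := fun q : E n × ℝ => u q.1 q.2 - paraboloid c k r t₁ ℓ A z q.1 q.2)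
    ⟨(x₁, s₁), hx₁, hs₁⟩
    ((hreg.cont.mono hsubset).sub (continuous_paraboloid c k r t₁ ℓ A z).continuousOn)
  simp only at hx₀ ht₀
  have hpos : u x₀ t₀ < paraboloid c k r t₁ ℓ A z x₀ t₀ := by
    have := hmin (show (x₁, s₁) ∈ K ×ˢ Icc t₁ t₂ from ⟨hx₁, hs₁⟩)
    simp only [mem_ofPred_eq] at this
    linarith
  have hx₀U : x₀ ∈ U := by
    by_contra h
    exact (hlat x₀ hx₀ h t₀ ht₀).not_gt hpos
  have ht₀₁ : t₁ < t₀ := by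
    rcases ht₀.1.lt_or_eq with h | h
    · exact h
    · subst h
      exact absurd (hinit x₀ hx₀) hpos.not_ge
  obtain ⟨ε, hε, hball⟩ := Metric.isOpen_iff.1 hU x₀ hx₀U
  have := hsup x₀ (hKΩ hx₀) t₀ ⟨ht₁.trans_lt ht₀₁, ht₀.2.trans ht₂⟩
    (paraboloid c k r t₁ ℓ A z) (isTestAt_paraboloid ..)
    ⟨min ε (t₀ - t₁), lt_min hε (by linarith), fun x _ t _ htt₀ hx ht => by
      have hxK : x ∈ K := hUK (hball (hx.trans_le (min_le_left _ _)))
      have ht' : t₁ ≤ t := by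
        have := ht.trans_le (min_le_right _ _)
        rw [Real.dist_eq, abs_lt] at this
        linarith
      exact hmin (show (x, t) ∈ K ×ˢ Icc t₁ t₂ from ⟨hxK, ht', htt₀.trans ht₀.2⟩)⟩
    (posSemidef_hessMatrix_paraboloid c k r t₁ ℓ A z hk x₀ t₀)
  rw [timeDeriv_paraboloid, det_hessMatrix_paraboloid] at this
  linarith

lemma det_symm_ne_zero (W : E n ≃L[ℝ] E n) :
    LinearMap.det ((W.symm : E n →L[ℝ] E n) : E n →ₗ[ℝ] E n) ≠ 0 := by
  have := (LinearEquiv.isUnit_det' W.symm.toLinearEquiv).ne_zero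
  exact this

/-- If a subsolution lies well below an affine function at the centre of an ellipsoid at time
`t₁`, it remains below it at the centre for a time controlled by the volume. -/
lemma subsolution_center_le {Ω : Set (E n)} {T Lam p : ℝ} {u : E n → ℝ → ℝ}
    (hreg : ParabolicRegular Ω 0 T u) (hsub : ViscSubsolution Lam p Ω 0 T u) (hLam : 0 < Lam)
    {t₁ t' b h : ℝ} {ℓ : E n →L[ℝ] ℝ} {m : E n} (W : E n ≃L[ℝ] E n) (hh : 0 < h)
    (ht₁ : 0 ≤ t₁) (htt : t₁ ≤ t') (ht' : t' ≤ T)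
    (hG : ∀ c, ‖c‖ ≤ 1 → m + W c ∈ Ω)
    (hu : ∀ c, ‖c‖ ≤ 1 → u (m + W c) t' ≤ b + ℓ (m + W c) + h)
    (hm : u m t₁ < b + ℓ m - 4 * h)
    (hrate : 2 * Lam * ((12 * h) ^ n *
      LinearMap.det ((W.symm : E n →L[ℝ] E n) : E n →ₗ[ℝ] E n) ^ 2) ^ p * (t' - t₁) ≤ h) :
    u m t' ≤ b + ℓ m - h := by
  set d := LinearMap.det ((W.symm : E n →L[ℝ] E n) : E n →ₗ[ℝ] E n) with hd
  have hd0 : d ≠ 0 := det_symm_ne_zero W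
  have hpos : 0 < ((12 * h) ^ n * d ^ 2) ^ p := by positivity
  set K : Set (E n) := (fun c => m + W c) '' closedBall 0 1 with hKdef
  set U : Set (E n) := {x | ‖W.symm (x - m)‖ < 1} with hUdef
  have hK : IsCompact K := (isCompact_closedBall 0 1).image (by fun_prop)
  have hU : IsOpen U := isOpen_lt (by fun_prop) continuous_const
  have hUK : U ⊆ K := fun x hx => ⟨W.symm (x - m), by
    rw [mem_closedBall, dist_zero_right]; exact le_of_lt hx, by simp⟩
  have hKΩ : K ⊆ Ω := by
    rintro _ ⟨c, hc, rfl⟩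
    exact hG c (by simpa using hc)
  have hmono : ∀ x ∈ K, ∀ t ∈ Icc t₁ t', u x t ≤ u x t' := fun x hx t ht =>
    hreg.mono x (subset_closure (hKΩ hx)) t ⟨ht₁.trans ht.1, ht.2.trans ht'⟩ t'
      ⟨ht₁.trans htt, ht'⟩ ht.2
  have hconv := hreg.conv t₁ ⟨ht₁, htt.trans ht'⟩
  have hm0 : m ∈ K := ⟨0, by simp, by simp⟩
  have key := le_paraboloid_of_subsolution hreg hsub (c := b - 2 * h) (k := 6 * h)
    (r := 2 * Lam * ((12 * h) ^ n * d ^ 2) ^ p) (t₁ := t₁) (t₂ := t') (ℓ := ℓ)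
    (A := (W.symm : E n →L[ℝ] E n)) (z := m) hK hU hUK hKΩ ht₁ ht' (by positivity)
    (by rw [show 2 * (6 * h) = 12 * h by ring, ← hd]; nlinarith) ?_ ?_ m hm0 t'
    ⟨htt, le_rfl⟩
  · simp only [paraboloid, sub_self, map_zero, norm_zero] at key
    linarith
  · rintro _ ⟨c, hc, rfl⟩
    rw [mem_closedBall, dist_zero_right] at hc
    simp only [paraboloid, add_sub_cancel_left, ContinuousLinearEquiv.coe_coe,
      ContinuousLinearEquiv.symm_apply_apply, sub_self, mul_zero, add_zero]
    rcases eq_or_ne c 0 with rfl | hc0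
    · simp only [map_zero, add_zero, norm_zero]
      linarith
    have hc1 : 0 < ‖c‖ := norm_pos_iff.2 hc0
    set c' := ‖c‖⁻¹ • c with hc'
    have hc'n : ‖c'‖ ≤ 1 := by
      rw [hc', norm_smul, norm_inv, norm_norm, inv_mul_cancel₀ hc1.ne']
    have hcc : c = ‖c‖ • c' := by rw [hc', smul_smul, mul_inv_cancel₀ hc1.ne', one_smul]
    have hmem : m + W c' ∈ K := ⟨c', by simpa using hc'n, rfl⟩
    have h1 := hconv.2 (subset_closure (hKΩ hm0)) (subset_closure (hKΩ hmem))
      (sub_nonneg.2 hc) hc1.le (by ring)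
    have h2 : (1 - ‖c‖) • m + ‖c‖ • (m + W c') = m + W c := by
      conv_rhs => rw [hcc, map_smul]
      module
    rw [h2] at h1
    simp only [smul_eq_mul] at h1
    have h3 := (hmono _ hmem t₁ ⟨le_rfl, htt⟩).trans (hu c' hc'n)
    have h4 : ℓ (m + W c) = (1 - ‖c‖) * ℓ m + ‖c‖ * ℓ (m + W c') := by
      rw [← h2, map_add, map_smul, map_smul, smul_eq_mul, smul_eq_mul]
    rw [h4]
    have h5 := mul_le_mul_of_nonneg_left h3 hc1.le
    have h6 := mul_le_mul_of_nonneg_left hm.le (sub_nonneg.2 hc)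
    nlinarith [mul_nonneg hh.le (sq_nonneg (12 * ‖c‖ - 5))]
  · rintro _ ⟨c, hc, rfl⟩ hcU t ht
    rw [mem_closedBall, dist_zero_right] at hc
    have hc1 : ‖c‖ = 1 := by
      refine le_antisymm hc ?_
      by_contra! h
      exact hcU (by simpa [hUdef] using h)
    have h1 := (hmono _ ⟨c, by simpa using hc, rfl⟩ t ht).trans (hu c hc)
    simp only [paraboloid, add_sub_cancel_left, ContinuousLinearEquiv.coe_coe,
      ContinuousLinearEquiv.symm_apply_apply, hc1]
    have : 0 ≤ 2 * Lam * ((12 * h) ^ n * d ^ 2) ^ p * (t - t₁) :=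
      mul_nonneg (by positivity) (sub_nonneg.2 ht.1)
    linarith

/-- A function which is nonnegative on average over every finite family with barycentre `0` has
an affine minorant through the origin. -/
lemma exists_linear_le {F : Type} [NormedAddCommGroup F] [NormedSpace ℝ F] {B : Set F}
    (hB : IsOpen B) (h0 : (0 : F) ∈ B) {W : F → ℝ} (hW : ContinuousOn W B)
    (hcomb : ∀ (ι : Type) [Fintype ι] (θ : ι → ℝ) (η : ι → F), (∀ i, 0 ≤ θ i) → ∑ i, θ i = 1 →
      (∀ i, η i ∈ B) → ∑ i, θ i • η i = 0 → 0 ≤ ∑ i, θ i * W (η i)) :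
    ∃ φ : F →L[ℝ] ℝ, ∀ η ∈ B, φ η ≤ W η := by
  set O : Set (F × ℝ) := {q | q.1 ∈ B ∧ W q.1 < q.2} with hO
  have hOo : IsOpen O := by
    have h1 : IsOpen (Prod.fst ⁻¹' B : Set (F × ℝ)) := hB.preimage continuous_fst
    have h2 : ContinuousOn (fun q : F × ℝ => q.2 - W q.1) (Prod.fst ⁻¹' B) :=
      continuousOn_snd.sub (hW.comp continuousOn_fst fun q hq => hq)
    have h3 := h2.isOpen_inter_preimage h1 isOpen_Ioi (t := Ioi (0:ℝ))
    convert h3 using 1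
    ext q
    simp [hO]
  have hnot : (0 : F × ℝ) ∉ convexHull ℝ O := by
    intro h
    obtain ⟨ι, _, θ, q, hθ, hsum, hq, hbar⟩ := mem_convexHull_iff_exists_fintype.1 h
    have h1 : ∑ i, θ i • (q i).1 = 0 := by
      simpa [Prod.fst_sum] using congrArg Prod.fst hbar
    have h2 : ∑ i, θ i * (q i).2 = 0 := by
      simpa [Prod.snd_sum] using congrArg Prod.snd hbar
    have h3 := hcomb ι θ (fun i => (q i).1) hθ hsum (fun i => (hq i).1) h1
    have h4 : ∑ i, θ i * W (q i).1 < ∑ i, θ i * (q i).2 := by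
      obtain ⟨j, hj⟩ : ∃ j, 0 < θ j := by
        by_contra! hc
        have : ∑ i, θ i ≤ 0 := Finset.sum_nonpos fun i _ => hc i
        linarith
      exact Finset.sum_lt_sum (fun i _ => mul_le_mul_of_nonneg_left (hq i).2.le (hθ i))
        ⟨j, Finset.mem_univ j, mul_lt_mul_of_pos_left (hq j).2 hj⟩
    linarith
  obtain ⟨f, hf⟩ := geometric_hahn_banach_open_point (convex_convexHull ℝ O)
    hOo.convexHull hnot
  have hf' : ∀ η ∈ B, ∀ s, W η < s → f (η, 0) + s * f (0, 1) < 0 := by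
    intro η hη s hs
    have h1 := hf (η, s) (subset_convexHull ℝ O ⟨hη, hs⟩)
    have h2 : ((η, s) : F × ℝ) = (η, 0) + s • (0, 1) := by simp
    rw [h2, map_add, map_smul, map_zero] at h1
    exact h1
  have hW0 : 0 ≤ W 0 := by
    simpa using hcomb Unit (fun _ => 1) (fun _ => 0) (by simp) (by simp) (by simpa) (by simp)
  have hc : f (0, 1) < 0 := by
    have h1 := hf' 0 h0 (W 0 + 1) (by linarith)
    have h2 : f ((0 : F), (0:ℝ)) = 0 := map_zero f
    rw [h2] at h1
    nlinarith
  refine ⟨(-(f (0, 1)))⁻¹ • f.comp (ContinuousLinearMap.inl ℝ F ℝ), fun η hη => ?_⟩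
  have h1 : f (η, 0) ≤ -(f (0, 1)) * W η := by
    refine le_of_forall_pos_lt_add fun ε hε => ?_
    have h2 := hf' η hη (W η + ε / (-(f (0, 1)))) (by linarith [div_pos hε (neg_pos.2 hc)])
    have h3 : ε / (-(f (0, 1))) * f (0, 1) = -ε := by
      rw [div_neg, neg_mul, div_mul_cancel₀ _ hc.ne]
    nlinarith
  simp only [smul_apply, ContinuousLinearMap.comp_apply, ContinuousLinearMap.inl_apply,
    smul_eq_mul]
  rw [inv_mul_le_iff₀ (neg_pos.2 hc)]
  exact h1

/-- The determinant of a family of `n` vectors of `ℝⁿ`. -/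
def stdDet (n : ℕ) : E n [⋀^Fin n]→ₗ[ℝ] ℝ := (EuclideanSpace.basisFun (Fin n) ℝ).toBasis.det

/-- The largest determinant of `n` vectors of `K`, up to constants the volume of `K` when `K` is
convex and symmetric. -/
def detVol (K : Set (E n)) : ℝ := sSup ((fun y => |stdDet n y|) '' {y | ∀ i, y i ∈ K})

lemma continuous_stdDet : Continuous fun y : Fin n → E n => stdDet n y := by
  have : (fun y : Fin n → E n => stdDet n y) =
      fun y => (Matrix.of fun i j => y j i).det := by
    ext y
    rw [stdDet, Module.Basis.det_apply]
    congr 1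
  rw [this]
  refine Continuous.matrix_det ?_
  fun_prop

lemma stdDet_single : stdDet n (fun i => EuclideanSpace.single i (1:ℝ)) = 1 := by
  have := Module.Basis.det_self (EuclideanSpace.basisFun (Fin n) ℝ).toBasis
  refine Eq.trans ?_ this
  unfold stdDet
  congr 1
  ext1 i
  simp

lemma isCompact_frames {K : Set (E n)} (hK : IsCompact K) :
    IsCompact {y : Fin n → E n | ∀ i, y i ∈ K} := by
  simpa [Set.pi] using isCompact_univ_pi (fun _ : Fin n => hK)

lemma bddAbove_detVol {K : Set (E n)} (hK : IsCompact K) :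
    BddAbove ((fun y => |stdDet n y|) '' {y | ∀ i, y i ∈ K}) :=
  ((isCompact_frames hK).image continuous_stdDet.abs).bddAbove

lemma abs_stdDet_le_detVol {K : Set (E n)} (hK : IsCompact K) {y : Fin n → E n}
    (hy : ∀ i, y i ∈ K) : |stdDet n y| ≤ detVol K :=
  le_csSup (bddAbove_detVol hK) ⟨y, hy, rfl⟩

lemma exists_frame_eq_detVol {K : Set (E n)} (hK : IsCompact K) (hne : K.Nonempty) :
    ∃ y : Fin n → E n, (∀ i, y i ∈ K) ∧ |stdDet n y| = detVol K := by
  obtain ⟨x, hx⟩ := hne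
  have := ((isCompact_frames hK).image continuous_stdDet.abs).sSup_mem ⟨_, (fun _ => x), fun _ => hx, rfl⟩
  obtain ⟨y, hy, h⟩ := this
  exact ⟨y, hy, h⟩

lemma detVol_nonneg (K : Set (E n)) : 0 ≤ detVol K :=
  Real.sSup_nonneg (by rintro _ ⟨y, _, rfl⟩; exact abs_nonneg _)

lemma pow_le_detVol {K : Set (E n)} (hK : IsCompact K) {r : ℝ} (hr : 0 ≤ r)
    (h : closedBall 0 r ⊆ K) : r ^ n ≤ detVol K := by
  have h1 := abs_stdDet_le_detVol hK (y := fun i => r • EuclideanSpace.single i (1:ℝ))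
    (fun i => h (by simp [norm_smul, abs_of_nonneg hr]))
  have h2 := (stdDet n).map_smul_univ (fun _ => r) (fun i => EuclideanSpace.single i (1:ℝ))
  rw [h2, stdDet_single] at h1
  simpa [abs_of_nonneg hr] using h1

lemma detVol_le_of_smul_mem {K K' : Set (E n)} (hK : IsCompact K) (hne : K.Nonempty)
    (hK' : IsCompact K') {c : ℝ} (hc : 0 ≤ c) (h : ∀ x ∈ K, c • x ∈ K') :
    c ^ n * detVol K ≤ detVol K' := by
  obtain ⟨y, hy, hV⟩ := exists_frame_eq_detVol hK hne
  have h1 := abs_stdDet_le_detVol hK' (y := fun i => c • y i) (fun i => h _ (hy i))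
  have h2 := (stdDet n).map_smul_univ (fun _ => c) y
  rw [h2] at h1
  simpa [abs_of_nonneg hc, hV] using h1

lemma exists_equiv_of_stdDet_ne_zero {y : Fin n → E n} (hy : stdDet n y ≠ 0) :
    ∃ W : E n ≃L[ℝ] E n, (∀ c, W c = ∑ i, c i • y i) ∧
      LinearMap.det ((W.symm : E n →L[ℝ] E n) : E n →ₗ[ℝ] E n) = (stdDet n y)⁻¹ := by
  set b := (EuclideanSpace.basisFun (Fin n) ℝ).toBasis with hb
  set f : E n →ₗ[ℝ] E n := b.constr ℝ y with hf
  have hdet : LinearMap.det f = stdDet n y := by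
    have h1 := b.det_comp f b
    rw [b.det_self, mul_one] at h1
    rw [← h1]
    congr 1
    ext1 i
    simp [hf]
  set e := LinearMap.equivOfDetNeZero f (hdet ▸ hy) with he
  have hee : (e : E n →ₗ[ℝ] E n) = f := by
    ext x; rfl
  refine ⟨e.toContinuousLinearEquiv, fun c => ?_, ?_⟩
  · have : e c = f c := rfl
    simp [this, hf, Module.Basis.constr_apply_fintype, hb]
  · have h1 : LinearMap.det (e.symm : E n →ₗ[ℝ] E n) * LinearMap.det (e : E n →ₗ[ℝ] E n) = 1 :=
      LinearEquiv.det_symm_mul_det e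
    rw [hee, hdet] at h1
    exact eq_inv_of_mul_eq_one_left h1

lemma stdDet_update {y : Fin n → E n} (c : Fin n → ℝ) (i : Fin n) :
    stdDet n (Function.update y i (∑ j, c j • y j)) = c i * stdDet n y := by
  rw [AlternatingMap.map_update_sum, Finset.sum_eq_single i]
  · rw [AlternatingMap.map_update_smul, Function.update_eq_self, smul_eq_mul]
  · intro j _ hj
    rw [AlternatingMap.map_update_smul, AlternatingMap.map_update_self _ _ hj.symm, smul_zero]
  · simp

/-- A frame of maximal determinant in `K`: every point of `K` has coordinates at most one. -/
lemma exists_max_frame {K : Set (E n)} (hK : IsCompact K) (hne : K.Nonempty)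
    (hpos : 0 < detVol K) :
    ∃ (y : Fin n → E n) (W : E n ≃L[ℝ] E n), (∀ i, y i ∈ K) ∧ |stdDet n y| = detVol K ∧
      (∀ c, W c = ∑ i, c i • y i) ∧
      LinearMap.det ((W.symm : E n →L[ℝ] E n) : E n →ₗ[ℝ] E n) ^ 2 = (detVol K ^ 2)⁻¹ ∧
      ∀ x ∈ K, ∀ i, |W.symm x i| ≤ 1 := by
  obtain ⟨y, hy, hV⟩ := exists_frame_eq_detVol hK hne
  have h0 : stdDet n y ≠ 0 := by
    intro h
    rw [h, abs_zero] at hV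
    linarith
  obtain ⟨W, hW, hdet⟩ := exists_equiv_of_stdDet_ne_zero h0
  refine ⟨y, W, hy, hV, hW, by rw [hdet, inv_pow, ← hV, sq_abs], fun x hx i => ?_⟩
  have h1 : stdDet n (Function.update y i x) = W.symm x i * stdDet n y := by
    conv_lhs => rw [← W.apply_symm_apply x, hW]
    exact stdDet_update _ i
  have h2 := abs_stdDet_le_detVol hK (y := Function.update y i x) (fun j => by
    rcases eq_or_ne j i with rfl | hj
    · simpa using hx
    · simpa [hj] using hy j)
  rw [h1, abs_mul, hV] at h2
  exact le_of_mul_le_mul_right (by linarith) hpos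

/-- The symmetrized gap `(u(z+η) + u(z-η)) / 2 - u(z)`. -/
def midGap (u : E n → ℝ → ℝ) (z : E n) (t : ℝ) (η : E n) : ℝ :=
  (u (z + η) t + u (z - η) t) / 2 - u z t

/-- The symmetrized section of height `H` centred at `z`. -/
def symSection (Ω : Set (E n)) (u : E n → ℝ → ℝ) (H : ℝ) (z : E n) (t : ℝ) : Set (E n) :=
  {η | z + η ∈ closure Ω ∧ z - η ∈ closure Ω ∧ midGap u z t η ≤ H}

lemma midGap_neg (u : E n → ℝ → ℝ) (z : E n) (t : ℝ) (η : E n) :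
    midGap u z t (-η) = midGap u z t η := by
  simp only [midGap, sub_neg_eq_add, ← sub_eq_add_neg, add_comm]

lemma neg_mem_symSection {Ω : Set (E n)} {u : E n → ℝ → ℝ} {H : ℝ} {z : E n} {t : ℝ} {η : E n}
    (h : η ∈ symSection Ω u H z t) : -η ∈ symSection Ω u H z t := by
  refine ⟨?_, ?_, by rw [midGap_neg]; exact h.2.2⟩
  · rw [← sub_eq_add_neg]; exact h.2.1
  · rw [sub_neg_eq_add]; exact h.1

lemma symSection_mono {Ω : Set (E n)} {u : E n → ℝ → ℝ} {H H' : ℝ} (hH : H ≤ H') (z : E n)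
    (t : ℝ) : symSection Ω u H z t ⊆ symSection Ω u H' z t :=
  fun _ h => ⟨h.1, h.2.1, h.2.2.trans hH⟩

lemma zero_mem_symSection {Ω : Set (E n)} {u : E n → ℝ → ℝ} {z : E n} {t H : ℝ} (hz : z ∈ closure Ω) (hH : 0 ≤ H) :
    (0 : E n) ∈ symSection Ω u H z t := by
  refine ⟨by simpa, by simpa, ?_⟩
  simpa [midGap] using hH

section
variable {Ω : Set (E n)} {T : ℝ} {u : E n → ℝ → ℝ} (hreg : ParabolicRegular Ω 0 T u)
include hreg

lemma continuousOn_slice {t : ℝ} (ht : t ∈ Icc 0 T) :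
    ContinuousOn (fun x => u x t) (closure Ω) :=
  hreg.cont.comp (f := fun x : E n => (x, t)) (by fun_prop) (fun _ hx => ⟨hx, ht⟩)

lemma midGap_smul_le {z η : E n} {t : ℝ} (ht : t ∈ Icc 0 T) (hz : z ∈ closure Ω)
    (h1 : z + η ∈ closure Ω) (h2 : z - η ∈ closure Ω) {c : ℝ} (hc : c ∈ Icc (0:ℝ) 1) :
    z + c • η ∈ closure Ω ∧ z - c • η ∈ closure Ω ∧
      midGap u z t (c • η) ≤ c * midGap u z t η := by
  have e1 : (1 - c) • z + c • (z + η) = z + c • η := by module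
  have e2 : (1 - c) • z + c • (z - η) = z - c • η := by module
  have hcv := hreg.conv t ht
  have c1 := hcv.1 hz h1 (sub_nonneg.2 hc.2) hc.1 (by ring)
  have c2 := hcv.1 hz h2 (sub_nonneg.2 hc.2) hc.1 (by ring)
  have i1 := hcv.2 hz h1 (sub_nonneg.2 hc.2) hc.1 (by ring)
  have i2 := hcv.2 hz h2 (sub_nonneg.2 hc.2) hc.1 (by ring)
  rw [e1] at c1 i1
  rw [e2] at c2 i2
  refine ⟨c1, c2, ?_⟩
  simp only [smul_eq_mul] at i1 i2
  simp only [midGap]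
  linarith

lemma midGap_nonneg {z η : E n} {t : ℝ} (ht : t ∈ Icc 0 T)
    (h1 : z + η ∈ closure Ω) (h2 : z - η ∈ closure Ω) : 0 ≤ midGap u z t η := by
  have hcv := hreg.conv t ht
  have i1 := hcv.2 h1 h2 (by norm_num : (0:ℝ) ≤ 1/2) (by norm_num : (0:ℝ) ≤ 1/2) (by norm_num)
  have e1 : (1/2 : ℝ) • (z + η) + (1/2 : ℝ) • (z - η) = z := by module
  rw [e1] at i1
  simp only [smul_eq_mul] at i1
  simp only [midGap]
  linarith

lemma smul_mem_symSection {z η : E n} {t H : ℝ} (ht : t ∈ Icc 0 T) (hz : z ∈ closure Ω)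
    (h : η ∈ symSection Ω u H z t) {c : ℝ} (hc : c ∈ Icc (0:ℝ) 1) :
    c • η ∈ symSection Ω u (c * H) z t := by
  obtain ⟨a, b, i⟩ := midGap_smul_le hreg ht hz h.1 h.2.1 hc
  exact ⟨a, b, i.trans (mul_le_mul_of_nonneg_left h.2.2 hc.1)⟩

lemma isCompact_symSection (hb : Bornology.IsBounded Ω) {z : E n} {t : ℝ} (H : ℝ)
    (ht : t ∈ Icc 0 T) : IsCompact (symSection Ω u H z t) := by
  have hc := continuousOn_slice hreg ht
  set D : Set (E n) := {η | z + η ∈ closure Ω ∧ z - η ∈ closure Ω} with hD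
  have hDc : IsCompact D := by
    have h1 : IsClosed D :=
      (isClosed_closure.preimage (by fun_prop : Continuous fun η : E n => z + η)).inter
        (isClosed_closure.preimage (by fun_prop : Continuous fun η : E n => z - η))
    refine Metric.isCompact_of_isClosed_isBounded h1 ?_
    obtain ⟨R, hR⟩ := hb.closure.subset_closedBall 0
    refine (isBounded_closedBall (x := (0 : E n)) (r := R + ‖z‖)).subset fun η hη => ?_
    have := hR hη.1
    rw [mem_closedBall, dist_zero_right] at this ⊢
    have h2 := norm_sub_le (z + η) z
    rw [add_sub_cancel_left] at h2
    linarith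
  have hcont : ContinuousOn (fun η => midGap u z t η) D := by
    unfold midGap
    refine ((ContinuousOn.add ?_ ?_).div_const 2).sub continuousOn_const
    · exact hc.comp (f := fun η => z + η) (by fun_prop) fun η hη => hη.1
    · exact hc.comp (f := fun η => z - η) (by fun_prop) fun η hη => hη.2
  have : symSection Ω u H z t = D ∩ (fun η => midGap u z t η) ⁻¹' Iic H := by
    ext η
    simp [symSection, hD, and_assoc]
  rw [this]
  exact hDc.of_isClosed_subset (hcont.preimage_isClosed_of_isClosed hDc.isClosed isClosed_Iic)
    inter_subset_left

lemma exists_closedBall_subset_symSection {z : E n} {t H : ℝ} (hz : z ∈ Ω) (hΩ : IsOpen Ω)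
    (ht : t ∈ Icc 0 T) (hH : 0 < H) :
    ∃ r > 0, closedBall (0 : E n) r ⊆ symSection Ω u H z t := by
  have hc : ContinuousAt (fun x => u x t) z :=
    (continuousOn_slice hreg ht).continuousAt
      (Filter.mem_of_superset (hΩ.mem_nhds hz) subset_closure)
  have h1 : ∀ᶠ x in nhds z, x ∈ Ω ∧ u x t < u z t + H := by
    exact Filter.Eventually.and (hΩ.mem_nhds hz)
      (hc.eventually_lt continuousAt_const (by linarith))
  obtain ⟨r, hr, hball⟩ := Metric.eventually_nhds_iff_ball.1 h1
  refine ⟨r / 2, by positivity, fun η hη => ?_⟩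
  rw [mem_closedBall, dist_zero_right] at hη
  have a1 := hball (z + η) (by simp; linarith)
  have a2 := hball (z - η) (by simp; linarith)
  refine ⟨subset_closure a1.1, subset_closure a2.1, ?_⟩
  simp only [midGap]
  linarith [a1.2, a2.2]

lemma detVol_symSection_pos (hb : Bornology.IsBounded Ω) {z : E n} {t H : ℝ} (hz : z ∈ Ω)
    (hΩ : IsOpen Ω) (ht : t ∈ Icc 0 T) (hH : 0 < H) : 0 < detVol (symSection Ω u H z t) := by
  obtain ⟨r, hr, h⟩ := exists_closedBall_subset_symSection hreg hz hΩ ht hH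
  exact (pow_pos hr n).trans_le (pow_le_detVol (isCompact_symSection hreg hb H ht) hr.le h)

end

/-- Dilation factor of the maximal frame used in the lower barrier. -/
def dilation (n : ℕ) : ℝ := 192 * n

section
variable {Ω : Set (E n)} {T : ℝ} {u : E n → ℝ → ℝ} (hreg : ParabolicRegular Ω 0 T u)
include hreg

/-- The quadratic polynomial with Hessian comparable to the symmetric section is, up to a linear
function, below `u` on a dilate of the section. -/
lemma exists_linear_add_quadratic_le (hn : 1 ≤ n) (W : E n ≃L[ℝ] E n) {z : E n} {t H : ℝ}
    (ht : t ∈ Icc 0 T) (hH : 0 < H)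
    (hdom : ∀ η, ‖W.symm η‖ < dilation n → z + η ∈ Ω)
    (hcoord : ∀ x ∈ symSection Ω u H z t, ∀ i, |W.symm x i| ≤ 1) :
    ∃ φ : E n →L[ℝ] ℝ, ∀ η, ‖W.symm η‖ < dilation n →
      φ η + H * (6 / dilation n ^ 2 * ‖W.symm η‖ ^ 2 - 1 / 4) ≤ u (z + η) t - u z t := by
  have hn' : (1:ℝ) ≤ n := by exact_mod_cast hn
  have hρ : 0 < dilation n := by unfold dilation; positivity
  set ρ := dilation n with hρdef
  set B : Set (E n) := {η | ‖W.symm η‖ < ρ} with hBdef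
  set w : E n → ℝ := fun η => u (z + η) t - u z t with hw
  have hBo : IsOpen B := isOpen_lt (by fun_prop) continuous_const
  have hB0 : (0 : E n) ∈ B := by simpa [hBdef] using hρ
  have hBneg : ∀ η ∈ B, -η ∈ B := fun η hη => by simpa [hBdef] using hη
  have hBc : Convex ℝ B := by
    have : B = W.symm ⁻¹' ball 0 ρ := by ext; simp [hBdef]
    rw [this]
    exact (convex_ball _ _).linear_preimage (W.symm : E n →L[ℝ] E n).toLinearMap
  have hz : z ∈ closure Ω := by simpa using subset_closure (hdom 0 hB0)
  have hmem : ∀ η ∈ B, z + η ∈ closure Ω := fun η hη => subset_closure (hdom η hη)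
  have hwc : ConvexOn ℝ B w := by
    refine ⟨hBc, fun x hx y hy a b ha hb hab => ?_⟩
    have h1 := (hreg.conv t ht).2 (hmem x hx) (hmem y hy) ha hb hab
    have h2 : a • (z + x) + b • (z + y) = z + (a • x + b • y) := by
      rw [smul_add, smul_add, add_add_add_comm, ← add_smul, hab, one_smul]
    rw [h2] at h1
    simp only [hw, smul_eq_mul] at h1 ⊢
    have h3 : a * u z t + b * u z t = u z t := by rw [← add_mul, hab, one_mul]
    linarith
  have hw0 : w 0 = 0 := by simp [hw]
  have hwcont : ContinuousOn w B :=
    ((continuousOn_slice hreg ht).comp (f := fun η => z + η) (by fun_prop) hmem).sub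
      continuousOn_const
  suffices hmain : ∃ φ : E n →L[ℝ] ℝ, ∀ η ∈ B,
      φ η ≤ w η - H * (6 / ρ ^ 2 * ‖W.symm η‖ ^ 2 - 1 / 4) by
    obtain ⟨φ, hφ⟩ := hmain
    exact ⟨φ, fun η hη => by linarith [hφ η hη]⟩
  refine exists_linear_le hBo hB0 (hwcont.sub (by fun_prop)) ?_
  intro ι _ θ η hθ hsum hη hbar
  have hJ : 0 ≤ ∑ j, θ j * w (η j) := by
    have := hwc.map_sum_le (fun j _ => hθ j) hsum (fun j _ => hη j)
    rw [hbar, hw0] at this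
    simpa using this
  set S := ∑ j, θ j * ‖W.symm (η j)‖ ^ 2 with hS
  have hexp : ∑ j, θ j * (w (η j) - H * (6 / ρ ^ 2 * ‖W.symm (η j)‖ ^ 2 - 1 / 4)) =
      ∑ j, θ j * w (η j) - H * (6 / ρ ^ 2 * S - 1 / 4) := by
    have : ∀ j, θ j * (w (η j) - H * (6 / ρ ^ 2 * ‖W.symm (η j)‖ ^ 2 - 1 / 4)) =
        θ j * w (η j) - H * (6 / ρ ^ 2) * (θ j * ‖W.symm (η j)‖ ^ 2) + H / 4 * θ j := by
      intro j; ring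
    simp only [this, Finset.sum_add_distrib, Finset.sum_sub_distrib, ← Finset.mul_sum, hsum, ← hS]
    ring
  rw [hexp]
  rcases le_or_gt (6 / ρ ^ 2 * S) (1 / 4) with hcase | hcase
  · nlinarith
  have hSle : S ≤ ρ ^ 2 := by
    calc S ≤ ∑ j, θ j * ρ ^ 2 := Finset.sum_le_sum fun j _ =>
          mul_le_mul_of_nonneg_left (pow_le_pow_left₀ (norm_nonneg _) (le_of_lt (hη j)) 2) (hθ j)
      _ = ρ ^ 2 := by rw [← Finset.sum_mul, hsum, one_mul]
  have hS6 : 6 / ρ ^ 2 * S ≤ 6 := by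
    rw [div_mul_eq_mul_div, div_le_iff₀ (by positivity)]
    linarith
  have hSgt : ρ ^ 2 / 24 < S := by
    rw [div_mul_eq_mul_div, lt_div_iff₀ (by positivity)] at hcase
    linarith
  obtain ⟨i, hi⟩ : ∃ i, ρ ^ 2 / (24 * n) < ∑ j, θ j * (W.symm (η j) i) ^ 2 := by
    by_contra! hcon
    have h1 : S = ∑ i, ∑ j, θ j * (W.symm (η j) i) ^ 2 := by
      rw [Finset.sum_comm, hS]
      refine Finset.sum_congr rfl fun j _ => ?_
      rw [EuclideanSpace.real_norm_sq_eq, Finset.mul_sum]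
    have h2 : S ≤ ∑ _i : Fin n, ρ ^ 2 / (24 * n) := h1 ▸ Finset.sum_le_sum fun i _ => hcon i
    rw [Finset.sum_const, Finset.card_univ, Fintype.card_fin, nsmul_eq_mul] at h2
    have h3 : (n:ℝ) * (ρ ^ 2 / (24 * n)) = ρ ^ 2 / 24 := by field_simp
    linarith
  have hcl : ∀ j, |W.symm (η j) i| ≤ ρ := fun j =>
    (by simpa using PiLp.norm_apply_le (W.symm (η j)) i : |W.symm (η j) i| ≤ _).trans
      (le_of_lt (hη j))
  have habs : ρ / (24 * n) < ∑ j, θ j * |W.symm (η j) i| := by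
    have h1 : ∑ j, θ j * (W.symm (η j) i) ^ 2 ≤ ρ * ∑ j, θ j * |W.symm (η j) i| := by
      rw [Finset.mul_sum]
      refine Finset.sum_le_sum fun j _ => ?_
      rw [← sq_abs]
      have := mul_le_mul_of_nonneg_left (hcl j) (mul_nonneg (hθ j) (abs_nonneg (W.symm (η j) i)))
      linarith
    have h2 : ρ ^ 2 / (24 * n) = ρ * (ρ / (24 * n)) := by ring
    rw [h2] at hi
    exact lt_of_mul_lt_mul_left (hi.trans_le h1) hρ.le
  have hρn : ρ / (24 * n) = 8 := by
    rw [hρdef, dilation]; field_simp; norm_num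
  rw [hρn] at habs
  set ηp : ι → E n := fun j => if 0 < W.symm (η j) i then η j else 0 with hηp
  set ηm : ι → E n := fun j => if 0 < W.symm (η j) i then 0 else η j with hηm
  have hηpB : ∀ j, ηp j ∈ B := fun j => by
    by_cases h : 0 < W.symm (η j) i <;> simp [hηp, h, hη j, hB0]
  have hηmB : ∀ j, ηm j ∈ B := fun j => by
    by_cases h : 0 < W.symm (η j) i <;> simp [hηm, h, hη j, hB0]
  have hηadd : ∀ j, ηp j + ηm j = η j := fun j => by
    by_cases h : 0 < W.symm (η j) i <;> simp [hηp, hηm, h]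
  have hwadd : ∀ j, w (ηp j) + w (ηm j) = w (η j) := fun j => by
    by_cases h : 0 < W.symm (η j) i <;> simp [hηp, hηm, h, hw0]
  set y := ∑ j, θ j • ηp j with hy
  have hyneg : ∑ j, θ j • ηm j = -y := by
    rw [eq_neg_iff_add_eq_zero, hy, ← Finset.sum_add_distrib, ← hbar]
    refine Finset.sum_congr rfl fun j _ => ?_
    rw [← smul_add, add_comm (ηm j), hηadd]
  have hyB : y ∈ B := hBc.sum_mem (fun j _ => hθ j) hsum fun j _ => hηpB j
  have hcoordy : 4 < W.symm y i := by
    have h1 : ∀ j, θ j * W.symm (ηp j) i = θ j * ((|W.symm (η j) i| + W.symm (η j) i) / 2) := by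
      intro j
      by_cases h : 0 < W.symm (η j) i
      · simp [hηp, h, abs_of_pos h]
      · simp [hηp, h, abs_of_nonpos (not_lt.1 h)]
    have h2 : W.symm y i = ∑ j, θ j * W.symm (ηp j) i := by
      simp [hy, map_sum]
    have h3 : ∑ j, θ j * W.symm (η j) i = 0 := by
      have := congrArg (fun v => W.symm v i) hbar
      simpa [map_sum] using this
    have h4 : W.symm y i = (∑ j, θ j * |W.symm (η j) i| + ∑ j, θ j * W.symm (η j) i) / 2 := by
      rw [h2, ← Finset.sum_add_distrib, Finset.sum_div]
      exact Finset.sum_congr rfl fun j _ => by rw [h1]; ring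
    rw [h4, h3]
    linarith
  have hgap : 3 * H < midGap u z t y := by
    by_contra! hle
    have hz1 := hmem y hyB
    have hz2 : z - y ∈ closure Ω := by
      rw [sub_eq_add_neg]; exact hmem _ (hBneg y hyB)
    have h1 := smul_mem_symSection hreg ht hz (c := 1/3) ⟨hz1, hz2, hle⟩
      ⟨by norm_num, by norm_num⟩
    rw [show (1/3 : ℝ) * (3 * H) = H by ring] at h1
    have h2 := hcoord _ h1 i
    rw [map_smul, PiLp.smul_apply, smul_eq_mul, abs_le] at h2
    linarith [h2.2]
  have hfin : 2 * midGap u z t y ≤ ∑ j, θ j * w (η j) := by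
    have h1 := hwc.map_sum_le (fun j _ => hθ j) hsum (fun j _ => hηpB j)
    have h2 := hwc.map_sum_le (fun j _ => hθ j) hsum (fun j _ => hηmB j)
    rw [hyneg] at h2
    rw [← hy] at h1
    simp only [smul_eq_mul] at h1 h2
    have h3 : ∑ j, θ j * w (η j) = ∑ j, θ j * w (ηp j) + ∑ j, θ j * w (ηm j) := by
      rw [← Finset.sum_add_distrib]
      exact Finset.sum_congr rfl fun j _ => by rw [← hwadd]; ring
    rw [h3]
    have h4 : 2 * midGap u z t y = w y + w (-y) := by
      simp only [midGap, hw, ← sub_eq_add_neg]; ring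
    linarith
  nlinarith

/-- If a supersolution grows little at `z`, then the elapsed time is controlled by the size of the
symmetric section. -/
lemma supersolution_time_le {lam p : ℝ} (hsup : ViscSupersolution lam p Ω 0 T u)
    (hlam : 0 < lam) (hn : 1 ≤ n) (hb : Bornology.IsBounded Ω) (hΩ : IsOpen Ω) {z : E n}
    {t₁ t₂ H R R' : ℝ} (ht₁ : 0 ≤ t₁) (htt : t₁ ≤ t₂) (ht₂ : t₂ ≤ T) (hH : 0 < H)
    (hR : symSection Ω u H z t₁ ⊆ closedBall 0 R) (hR' : closedBall z R' ⊆ Ω) (hR'0 : 0 ≤ R')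
    (hRR : dilation n * n * R ≤ R')
    (hrise : u z t₂ - u z t₁ ≤ H / 4) :
    (t₂ - t₁) * (lam * ((6 * H / dilation n ^ 2) ^ n *
      (detVol (symSection Ω u H z t₁) ^ 2)⁻¹) ^ p) ≤ 3 / 2 * H := by
  have hn' : (1:ℝ) ≤ n := by exact_mod_cast hn
  have hρ : 0 < dilation n := by unfold dilation; positivity
  have hzΩ : z ∈ Ω := hR' (mem_closedBall_self hR'0)
  have ht : t₁ ∈ Icc 0 T := ⟨ht₁, htt.trans ht₂⟩
  have hV := detVol_symSection_pos hreg hb hzΩ hΩ ht hH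
  have hK := isCompact_symSection hreg hb (z := z) H ht
  obtain ⟨y, W, hy, -, hW, hdet, hcoord⟩ := exists_max_frame hK
    ⟨0, zero_mem_symSection (subset_closure hzΩ) hH.le⟩ hV
  set ρ := dilation n with hρdef
  set V := detVol (symSection Ω u H z t₁) with hVdef
  have hdom : ∀ η, ‖W.symm η‖ < ρ → z + η ∈ Ω := by
    intro η hη
    refine hR' ?_
    rw [mem_closedBall, dist_eq_norm, add_sub_cancel_left, ← W.apply_symm_apply η, hW]
    have hR0 : ∀ i, ‖y i‖ ≤ R := fun i => by simpa using hR (hy i)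
    calc ‖∑ i, (W.symm η) i • y i‖ ≤ ∑ i, ‖(W.symm η) i • y i‖ := norm_sum_le _ _
      _ ≤ ∑ _i : Fin n, ρ * R := Finset.sum_le_sum fun i _ => by
          rw [norm_smul]
          exact mul_le_mul ((PiLp.norm_apply_le (W.symm η) i).trans hη.le) (hR0 i)
            (norm_nonneg _) hρ.le
      _ = ρ * n * R := by simp; ring
      _ ≤ R' := hRR
  obtain ⟨φ, hφ⟩ := exists_linear_add_quadratic_le hreg hn W ht hH hdom hcoord
  set D := lam * ((6 * H / ρ ^ 2) ^ n * (V ^ 2)⁻¹) ^ p with hD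
  have hDpos : 0 < D := by positivity
  by_contra! hcon
  set s := t₁ + 3 / 2 * H / D with hs
  have hst : s < t₂ := by
    have : 3 / 2 * H / D < t₂ - t₁ := (div_lt_iff₀ hDpos).2 hcon
    linarith
  have hs1 : t₁ ≤ s := by
    have : 0 ≤ 3 / 2 * H / D := by positivity
    linarith
  set K : Set (E n) := (fun c => z + W c) '' closedBall 0 (ρ / 2) with hKdef
  set U : Set (E n) := {x | ‖W.symm (x - z)‖ < ρ / 2} with hUdef
  have hKc : IsCompact K := (isCompact_closedBall 0 _).image (by fun_prop)
  have hU : IsOpen U := isOpen_lt (by fun_prop) continuous_const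
  have hUK : U ⊆ K := fun x hx => ⟨W.symm (x - z), by
    rw [mem_closedBall, dist_zero_right]; exact le_of_lt hx, by simp⟩
  have hlt : ∀ c : E n, ‖c‖ ≤ ρ / 2 → ‖W.symm (W c)‖ < ρ := fun c hc => by
    rw [W.symm_apply_apply]; linarith
  have hKΩ : K ⊆ Ω := by
    rintro _ ⟨c, hc, rfl⟩
    exact hdom _ (hlt c (by simpa using hc))
  have hzK : z ∈ K := ⟨0, mem_closedBall_self (by positivity), by simp⟩
  have key := paraboloid_le_of_supersolution hreg hsup (c := u z t₁ - φ z - H / 4)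
    (k := 3 * H / ρ ^ 2) (r := D / 2) (t₁ := t₁) (t₂ := s) (ℓ := φ)
    (A := (W.symm : E n →L[ℝ] E n)) (z := z) hKc hU hUK hKΩ ht₁ (hst.le.trans ht₂)
    (by positivity)
    (by
      rw [show 2 * (3 * H / ρ ^ 2) = 6 * H / ρ ^ 2 by ring, hdet, ← hD]
      linarith) ?_ ?_ z hzK s ⟨hs1, le_rfl⟩
  · simp only [paraboloid, sub_self, map_zero, norm_zero] at key
    have h1 : D / 2 * (s - t₁) = 3 / 4 * H := by
      rw [hs, add_sub_cancel_left]; field_simp; norm_num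
    have h2 := hreg.mono z (subset_closure hzΩ) s ⟨ht₁.trans hs1, hst.le.trans ht₂⟩ t₂
      ⟨ht₁.trans htt, ht₂⟩ hst.le
    rw [h1] at key
    norm_num at key
    linarith
  · rintro _ ⟨c, hc, rfl⟩
    rw [mem_closedBall, dist_zero_right] at hc
    have h1 := hφ (W c) (hlt c hc)
    simp only [paraboloid, add_sub_cancel_left, ContinuousLinearEquiv.coe_coe,
      ContinuousLinearEquiv.symm_apply_apply, sub_self, mul_zero, add_zero, map_add] at h1 ⊢
    have h2 : 0 ≤ 3 * H / ρ ^ 2 * ‖c‖ ^ 2 := by positivity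
    have h3 : H * (6 / ρ ^ 2 * ‖c‖ ^ 2 - 1 / 4) = 2 * (3 * H / ρ ^ 2 * ‖c‖ ^ 2) - H / 4 := by ring
    linarith
  · rintro _ ⟨c, hc, rfl⟩ hcU t ht'
    rw [mem_closedBall, dist_zero_right] at hc
    have hc1 : ‖c‖ = ρ / 2 := by
      refine le_antisymm hc ?_
      by_contra! h
      refine hcU ?_
      show ‖W.symm (z + W c - z)‖ < ρ / 2
      rwa [add_sub_cancel_left, W.symm_apply_apply]
    have h1 := hφ (W c) (hlt c hc)
    have h0 : z + W c ∈ K := ⟨c, by simpa using hc, rfl⟩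
    have h2 := hreg.mono _ (subset_closure (hKΩ h0)) t₁ ht t
      ⟨ht₁.trans ht'.1, (ht'.2.trans hst.le).trans ht₂⟩ ht'.1
    simp only [paraboloid, add_sub_cancel_left, ContinuousLinearEquiv.coe_coe,
      ContinuousLinearEquiv.symm_apply_apply, map_add, hc1] at h1 ⊢
    have h3 : D / 2 * (t - t₁) ≤ 3 / 4 * H := by
      have h4 : D / 2 * (t - t₁) ≤ D / 2 * (s - t₁) :=
        mul_le_mul_of_nonneg_left (by linarith [ht'.2]) (by positivity)
      have h5 : D / 2 * (s - t₁) = 3 / 4 * H := by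
        rw [hs, add_sub_cancel_left]; field_simp; norm_num
      linarith
    have h6 : 3 * H / ρ ^ 2 * (ρ / 2) ^ 2 = 3 / 4 * H := by field_simp; norm_num
    have h7 : H * (6 / ρ ^ 2 * (ρ / 2) ^ 2 - 1 / 4) = 5 / 4 * H := by field_simp; norm_num
    linarith

end

/-- Jensen's inequality for a combination of translates of a base point. -/
lemma ConvexOn.add_sum_smul_le {F : Type*} [AddCommGroup F] [Module ℝ F] {S : Set F} {f : F → ℝ}
    (hf : ConvexOn ℝ S f) {x : F} (hx : x ∈ S) {ι : Type*} [Fintype ι] {τ : ι → ℝ} {v : ι → F}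
    (hτ : ∀ i, 0 ≤ τ i) (hsum : ∑ i, τ i ≤ 1) (hv : ∀ i, x + v i ∈ S) :
    x + ∑ i, τ i • v i ∈ S ∧
      f (x + ∑ i, τ i • v i) ≤ f x + ∑ i, τ i * (f (x + v i) - f x) := by
  set θ : Option ι → ℝ := fun o => o.elim (1 - ∑ i, τ i) τ with hθ
  set q : Option ι → F := fun o => o.elim x (fun i => x + v i) with hq
  have h0 : ∀ o ∈ Finset.univ, 0 ≤ θ o := by
    rintro (_ | i) _
    · simpa [hθ] using hsum
    · exact hτ i
  have h1 : ∑ o, θ o = 1 := by simp [hθ, Fintype.sum_option]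
  have h2 : ∀ o ∈ Finset.univ, q o ∈ S := by
    rintro (_ | i) _
    · exact hx
    · exact hv i
  have h3 : ∑ o, θ o • q o = x + ∑ i, τ i • v i := by
    simp only [hθ, hq, Fintype.sum_option, Option.elim, smul_add, Finset.sum_add_distrib,
      ← Finset.sum_smul]
    module
  have h4 := hf.map_sum_le h0 h1 h2
  have h5 := hf.1.sum_mem h0 h1 h2
  rw [h3] at h4 h5
  refine ⟨h5, h4.trans_eq ?_⟩
  simp only [hθ, hq, Fintype.sum_option, Option.elim, smul_eq_mul, mul_sub,
    Finset.sum_sub_distrib, ← Finset.sum_mul]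
  ring

lemma add_sum_mem_of_isOpen {Ω : Set (E n)} (hΩ : IsOpen Ω) (hc : Convex ℝ Ω) {x : E n}
    (hx : x ∈ Ω) {ι : Type*} [Fintype ι] {τ : ι → ℝ} {v : ι → E n} (hτ : ∀ i, 0 ≤ τ i) {κ : ℝ}
    (hκ : 0 < κ) (hκ1 : κ < 1) (hsum : ∑ i, τ i ≤ κ) (hv : ∀ i, x + v i ∈ closure Ω) :
    x + ∑ i, τ i • v i ∈ Ω := by
  have h1 := (ConvexOn.add_sum_smul_le (f := fun _ => (0:ℝ)) (convexOn_const 0 hc.closure)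
    (subset_closure hx) (τ := fun i => τ i / κ) (fun i => div_nonneg (hτ i) hκ.le)
    (by rw [← Finset.sum_div]; exact (div_le_one hκ).2 hsum) hv).1
  have h2 := hc.combo_interior_closure_mem_interior (hΩ.interior_eq.symm ▸ hx) h1
    (sub_pos.2 hκ1) hκ.le (by ring)
  rw [hΩ.interior_eq] at h2
  convert h2 using 1
  have : κ • ∑ i, (τ i / κ) • v i = ∑ i, τ i • v i := by
    rw [Finset.smul_sum]
    refine Finset.sum_congr rfl fun i _ => ?_
    rw [smul_smul, mul_div_cancel₀ _ hκ.ne']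
  rw [smul_add, this]
  module

section
variable {Ω : Set (E n)} {T : ℝ} {u : E n → ℝ → ℝ} (hreg : ParabolicRegular Ω 0 T u)
include hreg

lemma sum_smul_mem_symSection {z : E n} {t H : ℝ} (ht : t ∈ Icc 0 T) (hz : z ∈ closure Ω)
    {y : Fin n → E n} {c : Fin n → ℝ} (hy : ∀ i, y i ∈ symSection Ω u H z t) (hH : 0 ≤ H)
    (hc : ∑ i, |c i| ≤ 1) : ∑ i, c i • y i ∈ symSection Ω u H z t := by
  have hgen : ∀ y' : Fin n → E n, (∀ i, y' i ∈ symSection Ω u H z t) →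
      z + ∑ i, |c i| • y' i ∈ closure Ω ∧
      u (z + ∑ i, |c i| • y' i) t ≤ u z t + ∑ i, |c i| * (u (z + y' i) t - u z t) := fun y' hy' =>
    (hreg.conv t ht).add_sum_smul_le hz (fun i => abs_nonneg _) hc fun i => (hy' i).1
  set y' : Fin n → E n := fun i => if 0 ≤ c i then y i else -y i with hy'
  have hy'm : ∀ i, y' i ∈ symSection Ω u H z t := fun i => by
    by_cases h : 0 ≤ c i
    · simpa [hy', h] using hy i
    · simpa [hy', h] using neg_mem_symSection (hy i)
  have hsum : ∑ i, c i • y i = ∑ i, |c i| • y' i := by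
    refine Finset.sum_congr rfl fun i _ => ?_
    by_cases h : 0 ≤ c i
    · simp [hy', h, abs_of_nonneg h]
    · simp [hy', h, abs_of_neg (not_le.1 h)]
  obtain ⟨a1, a2⟩ := hgen y' hy'm
  obtain ⟨b1, b2⟩ := hgen (fun i => -y' i) fun i => neg_mem_symSection (hy'm i)
  simp only [smul_neg, Finset.sum_neg_distrib, ← sub_eq_add_neg] at b1 b2
  rw [hsum]
  refine ⟨a1, b1, ?_⟩
  have h3 : ∑ i, |c i| * midGap u z t (y' i) ≤ ∑ i, |c i| * H :=
    Finset.sum_le_sum fun i _ => mul_le_mul_of_nonneg_left (hy'm i).2.2 (abs_nonneg _)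
  rw [← Finset.sum_mul] at h3
  have h4 : ∑ i, |c i| * midGap u z t (y' i) =
      (∑ i, |c i| * (u (z + y' i) t - u z t) + ∑ i, |c i| * (u (z - y' i) t - u z t)) / 2 := by
    rw [← Finset.sum_add_distrib, Finset.sum_div]
    exact Finset.sum_congr rfl fun i _ => by simp only [midGap]; ring
  have h5 := mul_le_mul_of_nonneg_right hc hH
  rw [one_mul] at h5
  simp only [midGap] at h3 h4 ⊢
  linarith

end

lemma subsolution_center_le_coord {Ω : Set (E n)} {T Lam p : ℝ} {u : E n → ℝ → ℝ}
    (hreg : ParabolicRegular Ω 0 T u) (hsub : ViscSubsolution Lam p Ω 0 T u) (hLam : 0 < Lam)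
    {t₁ t' a h : ℝ} (μ : Fin n → ℝ) {m : E n} (W : E n ≃L[ℝ] E n) (hh : 0 < h)
    (ht₁ : 0 ≤ t₁) (htt : t₁ ≤ t') (ht' : t' ≤ T)
    (hG : ∀ c, ‖c‖ ≤ 1 → m + W c ∈ Ω)
    (hu : ∀ c : E n, ‖c‖ ≤ 1 → u (m + W c) t' ≤ a + ∑ i, c i * μ i + h)
    (hm : u m t₁ < a - 4 * h)
    (hrate : 2 * Lam * ((12 * h) ^ n *
      LinearMap.det ((W.symm : E n →L[ℝ] E n) : E n →ₗ[ℝ] E n) ^ 2) ^ p * (t' - t₁) ≤ h) :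
    u m t' ≤ a - h := by
  set ℓ : E n →L[ℝ] ℝ := (∑ i, μ i • (EuclideanSpace.proj i : E n →L[ℝ] ℝ)).comp
    (W.symm : E n →L[ℝ] E n) with hℓ
  have hℓW : ∀ c, ℓ (W c) = ∑ i, c i * μ i := fun c => by
    simp [hℓ, mul_comm]
  have := subsolution_center_le hreg hsub hLam (b := a - ℓ m) (ℓ := ℓ) (m := m) W hh ht₁ htt ht' hG
    (fun c hc => by
      have := hu c hc
      rw [map_add, hℓW]
      linarith) (by linarith) hrate
  linarith

/-- Determinant of the frame obtained from a maximal frame in the upper barrier. -/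
def frameConst (n : ℕ) : ℝ := 8 * (1 / (32 * n)) ^ n

lemma frameConst_pos (hn : 1 ≤ n) : 0 < frameConst n := by
  have : (1:ℝ) ≤ n := by exact_mod_cast hn
  unfold frameConst; positivity

/-- If `u` is nearly affine on the segment `[x₀, x₀ + b]` at time `t'`, then its value at the
midpoint cannot have been much lower shortly before. -/
lemma le_midpoint_of_subsolution {Ω : Set (E n)} {T Lam p : ℝ} {u : E n → ℝ → ℝ}
    (hreg : ParabolicRegular Ω 0 T u) (hsub : ViscSubsolution Lam p Ω 0 T u) (hLam : 0 < Lam)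
    (hp : 0 < p) (hn : 1 ≤ n) (hb : Bornology.IsBounded Ω) (hΩ : IsOpen Ω) (hc : Convex ℝ Ω)
    {x₀ b : E n} {t₁ t' H μ : ℝ} (hx₀ : x₀ ∈ Ω) (ht₁ : 0 ≤ t₁) (htt : t₁ ≤ t') (ht' : t' ≤ T)
    (hH : 0 < H) (hμ : 0 < μ) (hbm : x₀ + b ∈ closure Ω)
    (hout : μ • b ∉ symSection Ω u H x₀ t')
    (hex : (u x₀ t' + u (x₀ + b) t') / 2 - u (x₀ + (1 / 2 : ℝ) • b) t' < H / 32)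
    (hrate : 2 * Lam * ((3 / 8 * H) ^ n *
      (μ / (frameConst n * detVol (symSection Ω u H x₀ t'))) ^ 2) ^ p * (t' - t₁) ≤ H / 32) :
    (u x₀ t' + u (x₀ + b) t') / 2 - H / 8 ≤ u (x₀ + (1 / 2 : ℝ) • b) t₁ := by
  have hn' : (1:ℝ) ≤ n := by exact_mod_cast hn
  have hn0 : (0:ℝ) < n := by linarith
  have ht : t' ∈ Icc 0 T := ⟨ht₁.trans htt, ht'⟩
  have hV := detVol_symSection_pos hreg hb hx₀ hΩ ht hH
  have hK := isCompact_symSection hreg hb (z := x₀) H ht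
  have hx₀c := subset_closure hx₀
  obtain ⟨y, W₀, hy, hyV, hW₀, -, hcoord⟩ := exists_max_frame hK
    ⟨0, zero_mem_symSection hx₀c hH.le⟩ hV
  set V := detVol (symSection Ω u H x₀ t') with hVdef
  obtain ⟨i₀, hi₀⟩ : ∃ i, 1 / (n * μ) < |W₀.symm b i| := by
    by_contra! hcon
    refine hout ?_
    have h1 : μ • b = ∑ i, (μ * W₀.symm b i) • y i := by
      conv_lhs => rw [← W₀.apply_symm_apply b, hW₀, Finset.smul_sum]
      exact Finset.sum_congr rfl fun i _ => by rw [smul_smul]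
    rw [h1]
    refine sum_smul_mem_symSection hreg ht hx₀c hy hH.le ?_
    calc ∑ i, |μ * W₀.symm b i| ≤ ∑ _i : Fin n, 1 / (n : ℝ) := Finset.sum_le_sum fun i _ => by
          rw [abs_mul, abs_of_pos hμ]
          have := mul_le_mul_of_nonneg_left (hcon i) hμ.le
          have h2 : μ * (1 / (n * μ)) = 1 / (n:ℝ) := by field_simp
          linarith
      _ = 1 := by simp; field_simp
  set κ : ℝ := 1 / (32 * n) with hκ
  have hκ0 : 0 < κ := by positivity
  set v : Fin n → E n := fun i => κ • y i with hv
  set w : Fin n → E n := Function.update v i₀ ((1 / 4 : ℝ) • b) with hw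
  have hdetw : stdDet n w = (1 / (4 * κ) * W₀.symm b i₀) * (κ ^ n * stdDet n y) := by
    have h1 : (1 / 4 : ℝ) • b = ∑ i, (1 / (4 * κ) * W₀.symm b i) • v i := by
      conv_lhs => rw [← W₀.apply_symm_apply b, hW₀, Finset.smul_sum]
      refine Finset.sum_congr rfl fun i _ => ?_
      rw [hv, smul_smul, smul_smul]
      congr 1
      field_simp
    rw [hw, h1, stdDet_update (fun i => 1 / (4 * κ) * W₀.symm b i)]
    have h2 := (stdDet n).map_smul_univ (fun _ => κ) y
    simp only [Finset.prod_const, Finset.card_univ, Fintype.card_fin, smul_eq_mul] at h2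
    rw [h2]
  have hdetw' : frameConst n * V / μ ≤ |stdDet n w| := by
    rw [hdetw, abs_mul, abs_mul, abs_mul, hyV, abs_of_pos (by positivity : 0 < 1 / (4 * κ)),
      abs_of_pos (by positivity : 0 < κ ^ n)]
    have h1 : frameConst n * V / μ = 1 / (4 * κ) * (1 / (n * μ)) * (κ ^ n * V) := by
      rw [frameConst, ← hκ]
      have : 1 / (4 * κ) = 8 * n := by rw [hκ]; field_simp; norm_num
      rw [this]; field_simp
    rw [h1]
    gcongr
  have hfc := frameConst_pos hn
  have hdpos : 0 < frameConst n * V / μ := by positivity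
  have hw0 : stdDet n w ≠ 0 := by
    intro h
    rw [h, abs_zero] at hdetw'
    linarith
  obtain ⟨W, hW, hWdet⟩ := exists_equiv_of_stdDet_ne_zero hw0
  set a := u x₀ t' with ha
  set B := u (x₀ + b) t' with hB
  set d : Fin n → ℝ := fun i => (u (x₀ + y i) t' - u (x₀ - y i) t') / 2 with hd
  set lam : Fin n → ℝ := fun i => if i = i₀ then (B - a) / 4 else κ * d i with hlam
  have hcomb : ∀ c : E n, ‖c‖ ≤ 1 → x₀ + (1 / 2 : ℝ) • b + W c ∈ Ω ∧
      u (x₀ + (1 / 2 : ℝ) • b + W c) t' ≤ (a + B) / 2 + ∑ i, c i * lam i + H / 32 := by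
    intro c hc1
    have hci : ∀ i, |c i| ≤ 1 := fun i => (by simpa using PiLp.norm_apply_le c i :
      |c i| ≤ ‖c‖).trans hc1
    set τ : Fin n → ℝ := fun i => if i = i₀ then 1 / 2 + c i / 4 else |c i| * κ with hτ
    set v' : Fin n → E n := fun i => if i = i₀ then b else if 0 ≤ c i then y i else -y i with hv'
    have hτ0 : ∀ i, 0 ≤ τ i := fun i => by
      have := abs_le.1 (hci i)
      by_cases h : i = i₀
      · simp only [hτ, h, if_true] at this ⊢
        rw [← h] at this ⊢
        linarith [this.1]
      · simp only [hτ, h, if_false]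
        positivity
    have hτle : ∀ i, τ i ≤ (if i = i₀ then 3 / 4 else 0) + κ := fun i => by
      have := abs_le.1 (hci i)
      by_cases h : i = i₀
      · simp only [hτ, if_pos h]
        linarith [this.2]
      · simp only [hτ, if_neg h, zero_add]
        nlinarith [hci i]
    have hκn : (n:ℝ) * κ = 1 / 32 := by rw [hκ]; field_simp
    have hτsum : ∑ i, τ i ≤ 25 / 32 := by
      refine (Finset.sum_le_sum fun i _ => hτle i).trans ?_
      rw [Finset.sum_add_distrib, Finset.sum_ite_eq']
      simp [hκn]
      norm_num
    have hv'mem : ∀ i, x₀ + v' i ∈ closure Ω := fun i => by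
      by_cases h : i = i₀
      · simpa [hv', h] using hbm
      · by_cases h2 : 0 ≤ c i
        · simpa [hv', h, h2] using (hy i).1
        · simpa [hv', h, h2, ← sub_eq_add_neg] using (hy i).2.1
    have hpt : x₀ + (1 / 2 : ℝ) • b + W c = x₀ + ∑ i, τ i • v' i := by
      have h1 : ∀ i, τ i • v' i = c i • w i + (if i = i₀ then (1 / 2 : ℝ) • b else 0) := by
        intro i
        by_cases h : i = i₀
        · subst h
          simp only [hτ, hv', hw, if_true, Function.update_self]
          module
        · by_cases h2 : 0 ≤ c i
          · simp only [hτ, hv', hw, hv, if_neg h, if_pos h2, Function.update_of_ne h,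
              abs_of_nonneg h2]
            module
          · simp only [hτ, hv', hw, hv, if_neg h, if_neg h2, Function.update_of_ne h,
              abs_of_neg (not_le.1 h2)]
            module
      rw [hW, Finset.sum_congr rfl fun i _ => h1 i, Finset.sum_add_distrib, Finset.sum_ite_eq']
      simp only [Finset.mem_univ, if_true]
      abel
    refine ⟨hpt ▸ add_sum_mem_of_isOpen hΩ hc hx₀ hτ0 (by norm_num) (by norm_num) hτsum hv'mem, ?_⟩
    have h2 := ((hreg.conv t' ht).add_sum_smul_le hx₀c hτ0 (by linarith) hv'mem).2
    rw [hpt]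
    have h3 : ∀ i, τ i * (u (x₀ + v' i) t' - u x₀ t') ≤
        (if i = i₀ then (B - a) / 2 else 0) + c i * lam i + κ * H := by
      intro i
      by_cases h : i = i₀
      · simp only [hτ, hv', hlam, if_pos h]
        have : 0 ≤ κ * H := by positivity
        linarith
      · have hg := (hy i).2.2
        simp only [midGap] at hg
        have h4 : |c i| * (κ * H) ≤ κ * H := by
          have : 0 ≤ κ * H := by positivity
          nlinarith [hci i]
        have h5 : 0 ≤ |c i| * κ := by positivity
        by_cases h2 : 0 ≤ c i
        · simp only [hτ, hv', hlam, if_neg h, if_pos h2]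
          have h6 : u (x₀ + y i) t' - u x₀ t' ≤ H + d i := by
            simp only [hd]; linarith
          have h7 := mul_le_mul_of_nonneg_left h6 h5
          have h8 : |c i| * κ * d i = c i * (κ * d i) := by rw [abs_of_nonneg h2]; ring
          linarith
        · simp only [hτ, hv', hlam, if_neg h, if_neg h2, ← sub_eq_add_neg]
          have h6 : u (x₀ - y i) t' - u x₀ t' ≤ H - d i := by
            simp only [hd]; linarith
          have h7 := mul_le_mul_of_nonneg_left h6 h5
          have h8 : |c i| * κ * d i = -(c i * (κ * d i)) := by rw [abs_of_neg (not_le.1 h2)]; ring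
          linarith
    have h4 := Finset.sum_le_sum fun i (_ : i ∈ Finset.univ) => h3 i
    rw [Finset.sum_add_distrib, Finset.sum_add_distrib, Finset.sum_ite_eq'] at h4
    simp only [Finset.mem_univ, if_true, Finset.sum_const, Finset.card_univ, Fintype.card_fin,
      nsmul_eq_mul] at h4
    have h5 : (n:ℝ) * (κ * H) = H / 32 := by rw [← mul_assoc, hκn]; ring
    linarith
  by_contra! hlt
  have hdet2 : LinearMap.det ((W.symm : E n →L[ℝ] E n) : E n →ₗ[ℝ] E n) ^ 2 ≤
      (μ / (frameConst n * V)) ^ 2 := by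
    rw [hWdet, ← sq_abs, abs_inv]
    have h1 : μ / (frameConst n * V) = (frameConst n * V / μ)⁻¹ := by rw [inv_div]
    rw [h1]
    gcongr
  have := subsolution_center_le_coord hreg hsub hLam (a := (a + B) / 2) (h := H / 32) lam
    (m := x₀ + (1 / 2 : ℝ) • b) W (by positivity) ht₁ htt ht' (fun c hc1 => (hcomb c hc1).1)
    (fun c hc1 => (hcomb c hc1).2) (by linarith) (by
      refine le_trans ?_ hrate
      rw [show 12 * (H / 32) = 3 / 8 * H by ring]
      have : 0 ≤ t' - t₁ := by linarith
      gcongr)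
  linarith

/-- If the gap is nearly linear between `η` and `2η` at time `t'`, then it was almost as large
shortly before. -/
lemma midGap_persists {Ω : Set (E n)} {T Lam p : ℝ} {u : E n → ℝ → ℝ}
    (hreg : ParabolicRegular Ω 0 T u) (hsub : ViscSubsolution Lam p Ω 0 T u) (hLam : 0 < Lam)
    (hp : 0 < p) (hn : 1 ≤ n) (hb : Bornology.IsBounded Ω) (hΩ : IsOpen Ω) (hc : Convex ℝ Ω)
    {x₀ η : E n} {t₁ t' δ : ℝ} (hx₀ : x₀ ∈ Ω) (ht₁ : 0 ≤ t₁) (htt : t₁ ≤ t') (ht' : t' ≤ T)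
    (hδ : 0 < δ) (hδ1 : 131 * δ ≤ 1) (h2p : x₀ + (2 : ℝ) • η ∈ closure Ω)
    (h2m : x₀ - (2 : ℝ) • η ∈ closure Ω) (hg : 0 < midGap u x₀ t' η)
    (hlin : midGap u x₀ t' ((2 : ℝ) • η) ≤ 2 * (1 + δ) * midGap u x₀ t' η)
    (hrate : 2 * Lam * ((3 / 8 * (128 * δ * midGap u x₀ t' η)) ^ n *
      (131 * δ / 2 / (frameConst n *
        detVol (symSection Ω u (128 * δ * midGap u x₀ t' η) x₀ t'))) ^ 2) ^ p * (t' - t₁) ≤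
        128 * δ * midGap u x₀ t' η / 32) :
    (1 - 16 * δ) * midGap u x₀ t' η ≤ midGap u x₀ t₁ η ∧
      u x₀ t' - u x₀ t₁ ≤ 128 * δ * midGap u x₀ t' η / 4 := by
  set g := midGap u x₀ t' η with hgdef
  set H := 128 * δ * g with hHdef
  have hH : 0 < H := by positivity
  have ht : t' ∈ Icc 0 T := ⟨ht₁.trans htt, ht'⟩
  have ht1 : t₁ ∈ Icc 0 T := ⟨ht₁, htt.trans ht'⟩
  have hx₀c := subset_closure hx₀
  have hδg : 0 < δ * g := mul_pos hδ hg
  obtain ⟨h1p, h1m, -⟩ := midGap_smul_le hreg ht hx₀c h2p h2m (c := 1/2) ⟨by norm_num, by norm_num⟩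
  rw [smul_smul] at h1p h1m
  norm_num at h1p h1m
  have hcv := hreg.conv t' ht
  have hcv1 := hreg.conv t₁ ht1
  have hout : 131 * δ / 2 ≠ 0 → (131 * δ / 2) • (2 : ℝ) • η ∉ symSection Ω u H x₀ t' := by
    intro _ hmem
    set σ := 131 * δ with hσ
    have hσ0 : 0 < σ := by positivity
    rw [smul_smul, show σ / 2 * 2 = σ by ring] at hmem
    have h2σ : 0 < 2 - σ := by linarith
    have hα : 0 ≤ 1 / (2 - σ) := by positivity
    have hβ : 0 ≤ (1 - σ) / (2 - σ) := div_nonneg (by linarith) h2σ.le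
    have hαβ : 1 / (2 - σ) + (1 - σ) / (2 - σ) = 1 := by field_simp; ring
    have hcoef : 1 / (2 - σ) * σ + (1 - σ) / (2 - σ) * 2 = 1 := by field_simp; ring
    have i1 := hcv.2 hmem.1 h2p hα hβ hαβ
    have i2 := hcv.2 hmem.2.1 h2m hα hβ hαβ
    have e1 : (1 / (2 - σ)) • (x₀ + σ • η) + ((1 - σ) / (2 - σ)) • (x₀ + (2 : ℝ) • η) =
        x₀ + η := by
      calc _ = (1 / (2 - σ) + (1 - σ) / (2 - σ)) • x₀ +
            (1 / (2 - σ) * σ + (1 - σ) / (2 - σ) * 2) • η := by module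
        _ = _ := by rw [hαβ, hcoef, one_smul, one_smul]
    have e2 : (1 / (2 - σ)) • (x₀ - σ • η) + ((1 - σ) / (2 - σ)) • (x₀ - (2 : ℝ) • η) =
        x₀ - η := by
      calc _ = (1 / (2 - σ) + (1 - σ) / (2 - σ)) • x₀ -
            (1 / (2 - σ) * σ + (1 - σ) / (2 - σ) * 2) • η := by module
        _ = _ := by rw [hαβ, hcoef, one_smul, one_smul]
    rw [e1] at i1
    rw [e2] at i2
    have h3 : g ≤ 1 / (2 - σ) * midGap u x₀ t' (σ • η) +
        (1 - σ) / (2 - σ) * midGap u x₀ t' ((2 : ℝ) • η) := by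
      simp only [smul_eq_mul] at i1 i2
      have h4 : u x₀ t' = 1 / (2 - σ) * u x₀ t' + (1 - σ) / (2 - σ) * u x₀ t' := by
        rw [← add_mul, hαβ, one_mul]
      simp only [hgdef, midGap]
      linarith
    have h5 : (2 - σ) * g ≤ midGap u x₀ t' (σ • η) + (1 - σ) * midGap u x₀ t' ((2 : ℝ) • η) := by
      have h6 := mul_le_mul_of_nonneg_left h3 h2σ.le
      have h7 : (2 - σ) * (1 / (2 - σ) * midGap u x₀ t' (σ • η) +
        (1 - σ) / (2 - σ) * midGap u x₀ t' ((2 : ℝ) • η)) = midGap u x₀ t' (σ • η) +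
          (1 - σ) * midGap u x₀ t' ((2 : ℝ) • η) := by field_simp
      linarith
    have h8 := mul_le_mul_of_nonneg_left hlin (by linarith : 0 ≤ 1 - σ)
    have h9 := hmem.2.2
    have h10 : 0 ≤ δ * g * σ := by positivity
    rw [hHdef] at h9
    nlinarith
  have hside : ∀ ζ : E n, (ζ = η ∨ ζ = -η) →
      (u x₀ t' + u (x₀ + (2 : ℝ) • ζ) t') / 2 - H / 8 ≤ u (x₀ + ζ) t₁ := by
    intro ζ hζ
    have hζm : x₀ + (2 : ℝ) • ζ ∈ closure Ω := by
      rcases hζ with rfl | rfl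
      · exact h2p
      · rwa [smul_neg, ← sub_eq_add_neg]
    have hζout : (131 * δ / 2) • (2 : ℝ) • ζ ∉ symSection Ω u H x₀ t' := by
      rcases hζ with rfl | rfl
      · exact hout (by positivity)
      · intro h
        have := neg_mem_symSection h
        rw [smul_neg, smul_neg, neg_neg] at this
        exact hout (by positivity) this
    have hhalf : x₀ + (1 / 2 : ℝ) • (2 : ℝ) • ζ = x₀ + ζ := by
      rw [smul_smul]; norm_num
    have hmid : ∀ ζ : E n, x₀ + (2 : ℝ) • ζ ∈ closure Ω →
        u (x₀ + ζ) t' ≤ (u x₀ t' + u (x₀ + (2 : ℝ) • ζ) t') / 2 := by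
      intro ζ hm
      have := hcv.2 hx₀c hm (by norm_num : (0:ℝ) ≤ 1/2) (by norm_num : (0:ℝ) ≤ 1/2) (by norm_num)
      rw [show (1/2 : ℝ) • x₀ + (1/2 : ℝ) • (x₀ + (2 : ℝ) • ζ) = x₀ + ζ by module] at this
      simp only [smul_eq_mul] at this
      linarith
    have hex : (u x₀ t' + u (x₀ + (2 : ℝ) • ζ) t') / 2 - u (x₀ + ζ) t' < H / 32 := by
      have a1 := hmid η h2p
      have a2 := hmid (-η) (by rwa [smul_neg, ← sub_eq_add_neg])
      rw [smul_neg, ← sub_eq_add_neg, ← sub_eq_add_neg] at a2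
      have a3 : midGap u x₀ t' ((2 : ℝ) • η) = (u (x₀ + (2 : ℝ) • η) t' +
        u (x₀ - (2 : ℝ) • η) t') / 2 - u x₀ t' := rfl
      have a4 : g = (u (x₀ + η) t' + u (x₀ - η) t') / 2 - u x₀ t' := rfl
      rcases hζ with rfl | rfl
      · linarith
      · rw [smul_neg, ← sub_eq_add_neg, ← sub_eq_add_neg]
        linarith
    have := le_midpoint_of_subsolution hreg hsub hLam hp hn hb hΩ hc hx₀ ht₁ htt ht' hH
      (μ := 131 * δ / 2) (by positivity) hζm hζout (by rwa [hhalf]) hrate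
    rwa [hhalf] at this
  have s1 := hside η (Or.inl rfl)
  have s2 := hside (-η) (Or.inr rfl)
  rw [smul_neg, ← sub_eq_add_neg, ← sub_eq_add_neg] at s2
  have hmono0 := hreg.mono x₀ hx₀c t₁ ht1 t' ht htt
  have hdouble : 2 * g ≤ midGap u x₀ t' ((2 : ℝ) • η) := by
    have := (midGap_smul_le hreg ht hx₀c h2p h2m (c := 1/2) ⟨by norm_num, by norm_num⟩).2.2
    rw [smul_smul] at this
    norm_num at this
    linarith
  constructor
  · have a3 : midGap u x₀ t' ((2 : ℝ) • η) = (u (x₀ + (2 : ℝ) • η) t' +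
        u (x₀ - (2 : ℝ) • η) t') / 2 - u x₀ t' := rfl
    have a5 : midGap u x₀ t₁ η = (u (x₀ + η) t₁ + u (x₀ - η) t₁) / 2 - u x₀ t₁ := rfl
    have a6 : H = 128 * (δ * g) := by rw [hHdef]; ring
    have a7 : (1 - 16 * δ) * g = g - 16 * (δ * g) := by ring
    linarith
  · have i1 := hcv1.2 hx₀c h2p (by norm_num : (0:ℝ) ≤ 1/2) (by norm_num : (0:ℝ) ≤ 1/2)
      (by norm_num)
    rw [show (1/2 : ℝ) • x₀ + (1/2 : ℝ) • (x₀ + (2 : ℝ) • η) = x₀ + η by module] at i1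
    simp only [smul_eq_mul] at i1
    have i2 := hreg.mono _ h2p t₁ ht1 t' ht htt
    linarith

/-- The convex hull of the graph of `x ↦ (u(x,t), ‖x - x₀‖²)`. -/
def graphHull (Ω : Set (E n)) (u : E n → ℝ → ℝ) (x₀ : E n) (t : ℝ) : Set (E n × ℝ × ℝ) :=
  convexHull ℝ ((fun x => (x, u x t, ‖x - x₀‖ ^ 2)) '' closure Ω)

/-- The second moments about `x₀` of the finitely supported probability measures with barycenter
`x₀` against which `u(·,t)` has mean at most `u(x₀,t) + H`. -/
def spreadSet (Ω : Set (E n)) (u : E n → ℝ → ℝ) (x₀ : E n) (H t : ℝ) : Set ℝ :=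
  {m | ∃ h ≤ u x₀ t + H, (x₀, h, m) ∈ graphHull Ω u x₀ t}

/-- The largest second moment in `spreadSet`. -/
def spread (Ω : Set (E n)) (u : E n → ℝ → ℝ) (x₀ : E n) (H t : ℝ) : ℝ :=
  sSup (spreadSet Ω u x₀ H t)

lemma zero_mem_spreadSet {Ω : Set (E n)} {u : E n → ℝ → ℝ} {x₀ : E n} {H t : ℝ}
    (hx₀ : x₀ ∈ closure Ω) (hH : 0 ≤ H) : (0 : ℝ) ∈ spreadSet Ω u x₀ H t :=
  ⟨u x₀ t, by linarith, subset_convexHull ℝ _ ⟨x₀, hx₀, by simp⟩⟩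

lemma bddAbove_spreadSet {Ω : Set (E n)} (hb : Bornology.IsBounded Ω) (u : E n → ℝ → ℝ)
    (x₀ : E n) : ∃ D : ℝ, ∀ H t, ∀ m ∈ spreadSet Ω u x₀ H t, m ≤ D := by
  obtain ⟨D, hD⟩ := hb.closure.subset_closedBall x₀
  refine ⟨D ^ 2, ?_⟩
  rintro H t m ⟨h, -, hm⟩
  have hsub : graphHull Ω u x₀ t ⊆ {q | q.2.2 ≤ D ^ 2} := by
    refine convexHull_min ?_ ?_
    · rintro _ ⟨x, hx, rfl⟩
      have := hD hx
      rw [mem_closedBall, dist_eq_norm] at this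
      exact pow_le_pow_left₀ (norm_nonneg _) this 2
    · exact convex_halfSpace_le (f := fun q : E n × ℝ × ℝ => q.2.2)
        ⟨fun _ _ => rfl, fun _ _ => rfl⟩ _
  exact hsub hm

lemma spread_nonneg {Ω : Set (E n)} (hb : Bornology.IsBounded Ω) {u : E n → ℝ → ℝ} {x₀ : E n}
    {H t : ℝ} (hx₀ : x₀ ∈ closure Ω) (hH : 0 ≤ H) : 0 ≤ spread Ω u x₀ H t := by
  obtain ⟨D, hD⟩ := bddAbove_spreadSet hb u x₀
  exact le_csSup ⟨D, fun m hm => hD H t m hm⟩ (zero_mem_spreadSet hx₀ hH)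

lemma le_spread {Ω : Set (E n)} (hb : Bornology.IsBounded Ω) {u : E n → ℝ → ℝ} {x₀ : E n}
    {H t m : ℝ} (hm : m ∈ spreadSet Ω u x₀ H t) : m ≤ spread Ω u x₀ H t := by
  obtain ⟨D, hD⟩ := bddAbove_spreadSet hb u x₀
  exact le_csSup ⟨D, fun m hm => hD H t m hm⟩ hm

lemma exists_spread_le {Ω : Set (E n)} (hb : Bornology.IsBounded Ω) (u : E n → ℝ → ℝ) {x₀ : E n}
    (hx₀ : x₀ ∈ closure Ω) : ∃ D : ℝ, ∀ H t, 0 ≤ H → spread Ω u x₀ H t ≤ D := by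
  obtain ⟨D, hD⟩ := bddAbove_spreadSet hb u x₀
  exact ⟨D, fun H t hH => csSup_le ⟨0, zero_mem_spreadSet hx₀ hH⟩ (hD H t)⟩

/-- Going back in time by an amount which lowers the center by at most `H' - H` increases the
spread. -/
lemma spread_le_spread {Ω : Set (E n)} (hb : Bornology.IsBounded Ω) {T : ℝ} {u : E n → ℝ → ℝ}
    (hreg : ParabolicRegular Ω 0 T u) {x₀ : E n} (hx₀ : x₀ ∈ closure Ω) {H H' t₁ t' : ℝ}
    (ht₁ : 0 ≤ t₁) (htt : t₁ ≤ t') (ht' : t' ≤ T) (hH : 0 ≤ H)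
    (hd : u x₀ t' + H ≤ u x₀ t₁ + H') :
    spread Ω u x₀ H t' ≤ spread Ω u x₀ H' t₁ := by
  refine csSup_le ⟨0, zero_mem_spreadSet hx₀ hH⟩ ?_
  rintro m ⟨h, hh, hm⟩
  have hsub : graphHull Ω u x₀ t' ⊆
      {q | ∃ h₁ ≤ q.2.1, (q.1, h₁, q.2.2) ∈ graphHull Ω u x₀ t₁} := by
    refine convexHull_min ?_ ?_
    · rintro _ ⟨x, hx, rfl⟩
      exact ⟨u x t₁, hreg.mono x hx t₁ ⟨ht₁, htt.trans ht'⟩ t' ⟨ht₁.trans htt, ht'⟩ htt,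
        subset_convexHull ℝ _ ⟨x, hx, rfl⟩⟩
    · rintro ⟨x, a, m⟩ ⟨h₁, h1, k1⟩ ⟨y, b, m'⟩ ⟨h₂, h2, k2⟩ c d hc hd hcd
      refine ⟨c * h₁ + d * h₂, ?_, convex_convexHull ℝ _ k1 k2 hc hd hcd⟩
      simp only [Prod.smul_mk, Prod.mk_add_mk, smul_eq_mul] at *
      exact add_le_add (mul_le_mul_of_nonneg_left h1 hc) (mul_le_mul_of_nonneg_left h2 hd)
  obtain ⟨h₁, h1, k⟩ := hsub hm
  exact le_spread hb ⟨h₁, by simp only at h1; linarith, k⟩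

lemma exists_weights_of_mem_spreadSet {Ω : Set (E n)} {u : E n → ℝ → ℝ} {x₀ : E n} {H t m : ℝ}
    (hm : m ∈ spreadSet Ω u x₀ H t) :
    ∃ (ι : Type) (_ : Fintype ι) (w : ι → ℝ) (X : ι → E n), Fintype.card ι ≤ n + 3 ∧
      (∀ i, 0 ≤ w i) ∧ ∑ i, w i = 1 ∧ (∀ i, X i ∈ closure Ω) ∧ ∑ i, w i • X i = x₀ ∧
      ∑ i, w i * u (X i) t ≤ u x₀ t + H ∧ ∑ i, w i * ‖X i - x₀‖ ^ 2 = m := by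
  obtain ⟨h, hh, hm⟩ := hm
  obtain ⟨ι, _, z, w, hz, hind, hw, hsum, hx⟩ := eq_pos_convex_span_of_mem_convexHull hm
  have hcard : Fintype.card ι ≤ n + 3 := by
    have := hind.card_le_finrank_succ
    have h2 : Module.finrank ℝ (vectorSpan ℝ (Set.range z)) ≤ n + 2 := by
      refine (Submodule.finrank_le _).trans ?_
      simp [Module.finrank_prod]
    omega
  choose X hX hXz using fun i => hz ⟨i, rfl⟩
  have e1 : ∑ i, w i • X i = x₀ := by
    have := congrArg Prod.fst hx
    simpa [Prod.fst_sum, ← hXz] using this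
  have e2 : ∑ i, w i * u (X i) t = h := by
    have := congrArg (fun q => q.2.1) hx
    simpa [Prod.fst_sum, Prod.snd_sum, ← hXz] using this
  have e3 : ∑ i, w i * ‖X i - x₀‖ ^ 2 = m := by
    have := congrArg (fun q => q.2.2) hx
    simpa [Prod.fst_sum, Prod.snd_sum, ← hXz] using this
  let f := Fintype.equivFin ι
  refine ⟨Fin (Fintype.card ι), inferInstance, w ∘ f.symm, X ∘ f.symm, by simpa using hcard,
    fun i => (hw _).le, ?_, fun i => hX _, ?_, ?_, ?_⟩
  · rw [← hsum]; exact Equiv.sum_comp f.symm w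
  · rw [← e1]; exact Equiv.sum_comp f.symm (fun i => w i • X i)
  · refine (Equiv.sum_comp f.symm (fun i => w i * u (X i) t)).trans_le ?_
    rw [e2]; exact hh
  · rw [← e3]; exact Equiv.sum_comp f.symm (fun i => w i * ‖X i - x₀‖ ^ 2)

/-- Splitting one of the points of an admissible tuple symmetrically. -/
lemma split_mem_spreadSet {Ω : Set (E n)} {u : E n → ℝ → ℝ}
    {x₀ : E n} {t H A : ℝ} {ι : Type}
    [Fintype ι] {w : ι → ℝ} {X : ι → E n} (hw : ∀ i, 0 ≤ w i) (hsum : ∑ i, w i = 1)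
    (hX : ∀ i, X i ∈ closure Ω) (hx : ∑ i, w i • X i = x₀)
    (hu : ∑ i, w i * u (X i) t + H ≤ u x₀ t + A) (hH : 0 ≤ H) (j : ι)
    {η : E n} (hη : η ∈ symSection Ω u H (X j) t) :
    ∑ i, w i * ‖X i - x₀‖ ^ 2 + w j * ‖η‖ ^ 2 ∈ spreadSet Ω u x₀ A t := by
  classical
  let q : ι → E n × ℝ × ℝ := fun i => (X i, u (X i) t, ‖X i - x₀‖ ^ 2) +
    if i = j then ((0 : E n), midGap u (X j) t η, ‖η‖ ^ 2) else 0
  have hq : ∀ i, q i ∈ graphHull Ω u x₀ t := by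
    intro i
    by_cases hij : i = j
    · subst hij
      have h1 : (X i + η, u (X i + η) t, ‖X i + η - x₀‖ ^ 2) ∈ graphHull Ω u x₀ t :=
        subset_convexHull ℝ _ ⟨_, hη.1, rfl⟩
      have h2 : (X i - η, u (X i - η) t, ‖X i - η - x₀‖ ^ 2) ∈ graphHull Ω u x₀ t :=
        subset_convexHull ℝ _ ⟨_, hη.2.1, rfl⟩
      have h3 : _ ∈ graphHull Ω u x₀ t := convex_convexHull ℝ _ h1 h2 (by norm_num : (0:ℝ) ≤ 1/2)
        (by norm_num : (0:ℝ) ≤ 1/2) (by norm_num)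
      convert h3 using 1
      have hpar := parallelogram_law_with_norm ℝ (X i - x₀) η
      have e1 : X i - x₀ + η = X i + η - x₀ := by abel
      have e2 : X i - x₀ - η = X i - η - x₀ := by abel
      rw [e1, e2] at hpar
      simp only [q, if_true, Prod.smul_mk, Prod.mk_add_mk, smul_eq_mul, midGap]
      ext1
      · simp only [add_zero]; module
      · ext1
        · simp only; ring
        · simp only; nlinarith
    · simp only [q, hij, if_false, add_zero]
      exact subset_convexHull ℝ _ ⟨_, hX i, rfl⟩
  have hmem : ∑ i, w i • q i ∈ graphHull Ω u x₀ t :=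
    (convex_convexHull ℝ _).sum_mem (fun i _ => hw i) hsum (fun i _ => hq i)
  have hqe : ∑ i, w i • q i = (x₀, ∑ i, w i * u (X i) t + w j * midGap u (X j) t η,
      ∑ i, w i * ‖X i - x₀‖ ^ 2 + w j * ‖η‖ ^ 2) := by
    simp only [q, smul_add, Finset.sum_add_distrib, smul_ite, smul_zero, Finset.sum_ite_eq',
      Finset.mem_univ, if_true]
    ext1
    · simp [Prod.fst_sum, hx]
    · ext1
      · simp [Prod.fst_sum, Prod.snd_sum]
      · simp [Prod.snd_sum]
  rw [hqe] at hmem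
  refine ⟨_, ?_, hmem⟩
  have hwj : w j ≤ 1 := by
    rw [← hsum]; exact Finset.single_le_sum (fun i _ => hw i) (Finset.mem_univ j)
  have := mul_le_mul_of_nonneg_left hη.2.2 (hw j)
  nlinarith

lemma smul_mem_symSection_of_weights {Ω : Set (E n)} {T : ℝ} {u : E n → ℝ → ℝ}
    (hreg : ParabolicRegular Ω 0 T u) {x₀ : E n} {t H A : ℝ} (ht : t ∈ Icc 0 T) {ι : Type}
    [Fintype ι] {w : ι → ℝ} {X : ι → E n} (hw : ∀ i, 0 ≤ w i) (hsum : ∑ i, w i = 1)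
    (hX : ∀ i, X i ∈ closure Ω) (hx : ∑ i, w i • X i = x₀)
    (hu : ∑ i, w i * u (X i) t + H ≤ u x₀ t + A) (hH : 0 ≤ H) (j : ι)
    {η : E n} (hη : η ∈ symSection Ω u H (X j) t) :
    w j • η ∈ symSection Ω u A x₀ t := by
  classical
  have hwj : w j ≤ 1 := by
    rw [← hsum]; exact Finset.single_le_sum (fun i _ => hw i) (Finset.mem_univ j)
  have key : ∀ ζ : E n, X j + ζ ∈ closure Ω → x₀ + w j • ζ ∈ closure Ω ∧
      u (x₀ + w j • ζ) t ≤ ∑ i, w i * u (X i) t + w j * (u (X j + ζ) t - u (X j) t) := by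
    intro ζ hζ
    let Y : ι → E n := fun i => X i + if i = j then ζ else 0
    have hY : ∀ i, Y i ∈ closure Ω := by
      intro i
      by_cases hij : i = j
      · subst hij; simpa [Y] using hζ
      · simpa [Y, hij] using hX i
    have hYs : ∑ i, w i • Y i = x₀ + w j • ζ := by
      simp [Y, smul_add, Finset.sum_add_distrib, hx]
    have hYu : ∑ i, w i * u (Y i) t =
        ∑ i, w i * u (X i) t + w j * (u (X j + ζ) t - u (X j) t) := by
      have : ∀ i, w i * u (Y i) t = w i * u (X i) t +
          if i = j then w j * (u (X j + ζ) t - u (X j) t) else 0 := by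
        intro i
        by_cases hij : i = j
        · subst hij; simp [Y]; ring
        · simp [Y, hij]
      simp [this, Finset.sum_add_distrib]
    have hcv := hreg.conv t ht
    rw [← hYs, ← hYu]
    refine ⟨hcv.1.sum_mem (fun i _ => hw i) hsum (fun i _ => hY i), ?_⟩
    simpa using hcv.map_sum_le (t := Finset.univ) (w := w) (p := Y) (fun i _ => hw i) hsum
      (fun i _ => hY i)
  obtain ⟨a1, a2⟩ := key η hη.1
  obtain ⟨b1, b2⟩ := key (-η) (by rw [← sub_eq_add_neg]; exact hη.2.1)
  rw [smul_neg, ← sub_eq_add_neg] at b1 b2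
  rw [← sub_eq_add_neg] at b2
  refine ⟨a1, b1, ?_⟩
  have h3 := hη.2.2
  have := mul_le_mul_of_nonneg_left h3 (hw j)
  simp only [midGap] at this h3 ⊢
  nlinarith

/-- If a convex body `K₁` contains a multiple of `K` and a point much further away than the
diameter of `K`, then its volume is much larger. -/
lemma detVol_le_of_far_point {K K₁ : Set (E n)} (hK : IsCompact K) (hne : K.Nonempty)
    (hpos : 0 < detVol K) (hK₁ : IsCompact K₁) {ϱ q R : ℝ} (hq : 0 ≤ q)
    (hϱ : K ⊆ closedBall 0 ϱ) (h : ∀ x ∈ K, q • x ∈ K₁) {β : E n} (hβ : q • β ∈ K₁)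
    (hR : 0 ≤ R) (hR' : R < ‖β‖) : q ^ n * R * detVol K ≤ n * ϱ * detVol K₁ := by
  obtain ⟨y, W, hy, hdet, hW, -, -⟩ := exists_max_frame hK hne hpos
  set c := W.symm β with hc
  have hβc : β = ∑ i, c i • y i := by rw [← hW, hc]; simp
  have hyn : ∀ i, ‖y i‖ ≤ ϱ := fun i => by simpa using hϱ (hy i)
  obtain ⟨i, hi⟩ : ∃ i, R ≤ n * ϱ * |c i| := by
    by_contra! hcon
    have hsum : ‖β‖ ≤ ∑ i, |c i| * ϱ := by
      rw [hβc]
      refine (norm_sum_le _ _).trans (Finset.sum_le_sum fun i _ => ?_)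
      rw [norm_smul, Real.norm_eq_abs]
      exact mul_le_mul_of_nonneg_left (hyn i) (abs_nonneg _)
    rcases Nat.eq_zero_or_pos n with rfl | hn
    · simp at hsum
      simp only [hsum, norm_zero] at hR'
      linarith
    · have hn' : (0:ℝ) < n := by exact_mod_cast hn
      have hle : ∑ i, |c i| * ϱ ≤ ∑ _i : Fin n, R / n := by
        refine Finset.sum_le_sum fun i _ => ?_
        rw [le_div_iff₀ hn']
        nlinarith [hcon i]
      rw [Finset.sum_const, Finset.card_univ, Fintype.card_fin, nsmul_eq_mul,
        mul_div_cancel₀ _ hn'.ne'] at hle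
      linarith
  have hup : |stdDet n (fun j => q • Function.update y i β j)| ≤ detVol K₁ := by
    refine abs_stdDet_le_detVol hK₁ fun j => ?_
    by_cases hj : j = i
    · subst hj; simpa using hβ
    · simpa [hj] using h _ (hy j)
  have heq : stdDet n (fun j => q • Function.update y i β j) = q ^ n * (c i * stdDet n y) := by
    have := (stdDet n).toMultilinearMap.map_smul_univ (fun _ => q) (Function.update y i β)
    rw [← stdDet_update, ← hβc]
    simpa using this
  rw [heq, abs_mul, abs_mul, hdet, abs_of_nonneg (pow_nonneg hq n)] at hup
  have hϱn : 0 ≤ ϱ := (norm_nonneg _).trans (hyn i)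
  have h1 := mul_le_mul_of_nonneg_left hi (mul_nonneg (pow_nonneg hq n) hpos.le)
  have h2 := mul_le_mul_of_nonneg_left hup (mul_nonneg (Nat.cast_nonneg (α := ℝ) n) hϱn)
  nlinarith

/-- In a tuple along which `u` is on average well below `1`, some point of not too small weight
has `u` below `1`. -/
lemma exists_weight_ge {ι : Type} [Fintype ι] {w v : ι → ℝ} {N ε : ℝ} (hN : 0 < N) (hε : 0 < ε)
    (hcard : (Fintype.card ι : ℝ) ≤ N)
    (hw : ∀ i, 0 ≤ w i) (hsum : ∑ i, w i = 1) (hv : ∀ i, 0 ≤ v i)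
    (hav : ∑ i, w i * v i ≤ 1 - 3 / 4 * ε) : ∃ i, ε / (4 * N) ≤ w i ∧ v i ≤ 1 - ε / 4 := by
  by_contra! hcon
  have h : ∀ i, w i * (1 - ε / 4) - ε / (4 * N) ≤ w i * v i := by
    intro i
    by_cases hi : ε / (4 * N) ≤ w i
    · have := mul_le_mul_of_nonneg_left (hcon i hi).le (hw i)
      have : 0 < ε / (4 * N) := by positivity
      linarith
    · have := mul_nonneg (hw i) (hv i)
      nlinarith [hw i]
  have h2 := Finset.sum_le_sum fun i (_ : i ∈ Finset.univ) => h i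
  rw [Finset.sum_sub_distrib, ← Finset.sum_mul, hsum, Finset.sum_const, Finset.card_univ,
    nsmul_eq_mul] at h2
  have h3 : (Fintype.card ι : ℝ) * (ε / (4 * N)) ≤ ε / 4 := by
    calc (Fintype.card ι : ℝ) * (ε / (4 * N)) ≤ N * (ε / (4 * N)) := by gcongr
      _ = ε / 4 := by field_simp
  linarith

/-- The time elapsed is at most what the supersolution property allows for a section of height
`H` with determinant volume `V`. -/
def TimeBound (n : ℕ) (lam p H V τ : ℝ) : Prop :=
  τ * (lam * ((6 * H / dilation n ^ 2) ^ n * (V ^ 2)⁻¹) ^ p) ≤ 3 / 2 * H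

lemma dilation_pos (hn : 1 ≤ n) : 0 < dilation n := by
  have : (1:ℝ) ≤ n := by exact_mod_cast hn
  unfold dilation; positivity

lemma TimeBound.of_height_mul {lam p H V V₁ τ C κ : ℝ} (hn : 1 ≤ n) (hp : 0 < p) (hlam : 0 < lam)
    (hH : 0 < H) (hτ : 0 ≤ τ) (hC : 1 ≤ C) (hV : 0 < V) (hV₁ : 0 < V₁) (hκ : 0 < κ)
    (hκC : C ≤ ((κ ^ 2)⁻¹) ^ p) (hVV : V ≤ κ * V₁) (h : TimeBound n lam p (C * H) V τ) :
    TimeBound n lam p H V₁ τ := by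
  have hρ := dilation_pos hn
  unfold TimeBound at *
  have hC0 : 0 < C := by linarith
  have h1 : (κ ^ 2)⁻¹ * ((6 * H / dilation n ^ 2) ^ n * (V₁ ^ 2)⁻¹) ≤
      (6 * (C * H) / dilation n ^ 2) ^ n * (V ^ 2)⁻¹ := by
    have a1 : (6 * H / dilation n ^ 2) ^ n ≤ (6 * (C * H) / dilation n ^ 2) ^ n := by
      gcongr
      nlinarith
    have a2 : (κ ^ 2)⁻¹ * (V₁ ^ 2)⁻¹ ≤ (V ^ 2)⁻¹ := by
      rw [← mul_inv, ← mul_pow]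
      gcongr
    calc _ = (6 * H / dilation n ^ 2) ^ n * ((κ ^ 2)⁻¹ * (V₁ ^ 2)⁻¹) := by ring
      _ ≤ _ := by gcongr
  have h2 : C * ((6 * H / dilation n ^ 2) ^ n * (V₁ ^ 2)⁻¹) ^ p ≤
      ((6 * (C * H) / dilation n ^ 2) ^ n * (V ^ 2)⁻¹) ^ p := by
    calc _ ≤ ((κ ^ 2)⁻¹) ^ p * ((6 * H / dilation n ^ 2) ^ n * (V₁ ^ 2)⁻¹) ^ p := by gcongr
      _ = ((κ ^ 2)⁻¹ * ((6 * H / dilation n ^ 2) ^ n * (V₁ ^ 2)⁻¹)) ^ p := by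
          exact (Real.mul_rpow (by positivity) (by positivity)).symm
      _ ≤ _ := by gcongr
  have h3 := mul_le_mul_of_nonneg_left h2 (mul_nonneg hτ hlam.le)
  refine le_of_mul_le_mul_left ?_ hC0
  linarith

set_option maxHeartbeats 1000000 in
/-- Either the time elapsed while the center rises by `H / 4` is controlled by the supersolution
property, or the spread increases by a definite amount. -/
lemma timeBound_or_spread {Ω : Set (E n)} {T lam p : ℝ} {u : E n → ℝ → ℝ}
    (hreg : ParabolicRegular Ω 0 T u) (hsup : ViscSupersolution lam p Ω 0 T u)
    (hlam : 0 < lam) (hp : 0 < p) (hn : 1 ≤ n) (hb : Bornology.IsBounded Ω) (hΩ : IsOpen Ω)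
    (hnonneg : ∀ x ∈ closure Ω, ∀ t ∈ Icc 0 T, 0 ≤ u x t) (hfr : ∀ x ∈ frontier Ω, 1 ≤ u x 0)
    {x₀ : E n} {tf : ℝ} (hx₀ : x₀ ∈ Ω) (htf : tf ∈ Icc 0 T) (hlt : u x₀ tf < 1) :
    ∃ Q ≥ (2:ℝ), ∃ ν > (0:ℝ), ∃ H₀ > (0:ℝ), ∀ H t₁ t', 0 < H → H ≤ H₀ → 0 ≤ t₁ → t₁ ≤ t' →
      t' ≤ tf → u x₀ t' - u x₀ t₁ ≤ H / 4 →
      TimeBound n lam p H (detVol (symSection Ω u H x₀ t₁)) (t' - t₁) ∨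
        spread Ω u x₀ H t' + ν ≤ spread Ω u x₀ (Q * H) t₁ := by
  have hρ := dilation_pos hn
  have hn' : (0:ℝ) < n := by exact_mod_cast hn
  have hx₀c := subset_closure hx₀
  have hT0 : (0:ℝ) ∈ Icc 0 T := ⟨le_rfl, htf.1.trans htf.2⟩
  obtain ⟨R₀, hR₀, hR₀Ω⟩ : ∃ R > 0, closedBall x₀ R ⊆ Ω :=
    nhds_basis_closedBall.mem_iff.1 (hΩ.mem_nhds hx₀)
  set ε := 1 - u x₀ tf with hε
  have hε0 : 0 < ε := by linarith
  have hε1 : ε ≤ 1 := by linarith [hnonneg x₀ hx₀c tf htf]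
  obtain ⟨d₀, hd₀, hd₀Ω⟩ : ∃ d > 0, ∀ x ∈ closure Ω, u x 0 ≤ 1 - ε / 4 → closedBall x d ⊆ Ω := by
    have hcl : IsClosed {x ∈ closure Ω | u x 0 ≤ 1 - ε / 4} := by
      have := (continuousOn_slice hreg hT0).preimage_isClosed_of_isClosed isClosed_closure
        (isClosed_Iic (a := 1 - ε / 4))
      exact this
    have hcomp : IsCompact {x ∈ closure Ω | u x 0 ≤ 1 - ε / 4} :=
      hb.isCompact_closure.of_isClosed_subset hcl (fun x hx => hx.1)
    have hsub : {x ∈ closure Ω | u x 0 ≤ 1 - ε / 4} ⊆ Ω := by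
      rintro x ⟨hx, hux⟩
      by_contra hxΩ
      have := hfr x ⟨hx, by rwa [hΩ.interior_eq]⟩
      linarith
    obtain ⟨d, hd, hdΩ⟩ := hcomp.exists_cthickening_subset_open hΩ hsub
    refine ⟨d, hd, fun x hx hux => ?_⟩
    exact (closedBall_subset_cthickening (show x ∈ {x ∈ closure Ω | u x 0 ≤ 1 - ε / 4} from
      ⟨hx, hux⟩) d).trans hdΩ
  set N : ℝ := n + 3 with hN
  have hN0 : 0 < N := by positivity
  set θ := ε / (4 * N) with hθ
  have hθ0 : 0 < θ := by positivity
  have hθ1 : θ ≤ 1 := by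
    rw [hθ, div_le_one (by positivity)]
    have : (0:ℝ) ≤ n := Nat.cast_nonneg n
    linarith
  set C := 5 / θ with hC
  have hC1 : 1 ≤ C := by rw [hC, le_div_iff₀ hθ0]; linarith
  have hCθ : C * θ = 5 := by rw [hC]; field_simp
  have hC0 : 0 < C := by linarith
  set κ : ℝ := C ^ (-(1 / (2 * p))) with hκ
  have hκ0 : 0 < κ := Real.rpow_pos_of_pos hC0 _
  have hκC : C ≤ ((κ ^ 2)⁻¹) ^ p := by
    have e : (κ ^ 2)⁻¹ = C ^ (1 / p) := by
      rw [hκ, ← Real.rpow_natCast, ← Real.rpow_mul hC0.le, ← Real.rpow_neg hC0.le]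
      congr 1
      push_cast
      field_simp
    rw [e, ← Real.rpow_mul hC0.le, one_div_mul_cancel hp.ne', Real.rpow_one]
  set q := θ / (C + 2) with hq
  have hq0 : 0 < q := by positivity
  have hq1 : q ≤ 1 := by rw [hq, div_le_one (by positivity)]; linarith
  set β₀ := R₀ / (dilation n * n) with hβ₀
  have hβ₀0 : 0 < β₀ := by positivity
  set ϱ := min (d₀ / (dilation n * n)) (κ * β₀ * q ^ n / n) with hϱ
  have hϱ0 : 0 < ϱ := lt_min (by positivity) (by positivity)
  have hϱd : dilation n * n * ϱ ≤ d₀ := by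
    have : ϱ ≤ d₀ / (dilation n * n) := min_le_left _ _
    rw [le_div_iff₀ (by positivity)] at this
    linarith
  have hϱκ : n * ϱ ≤ κ * β₀ * q ^ n := by
    have : ϱ ≤ κ * β₀ * q ^ n / n := min_le_right _ _
    rw [le_div_iff₀ hn'] at this
    linarith
  refine ⟨C + 2, by linarith, θ * ϱ ^ 2 / 2, by positivity, ε / 4, by positivity, ?_⟩
  intro H t₁ t' hH hHε ht₁ htt ht'f hdrop
  have ht' : t' ≤ T := ht'f.trans htf.2
  have ht₁I : t₁ ∈ Icc 0 T := ⟨ht₁, htt.trans ht'⟩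
  have ht'I : t' ∈ Icc 0 T := ⟨ht₁.trans htt, ht'⟩
  by_cases hcase : symSection Ω u H x₀ t₁ ⊆ closedBall 0 β₀
  · left
    refine supersolution_time_le hreg hsup hlam hn hb hΩ ht₁ htt ht' hH hcase hR₀Ω hR₀.le ?_ hdrop
    rw [hβ₀]; field_simp; rfl
  obtain ⟨β, hβ, hβn⟩ := Set.not_subset.1 hcase
  rw [mem_closedBall, dist_zero_right, not_le] at hβn
  by_cases hsp : spread Ω u x₀ H t' + θ * ϱ ^ 2 / 2 ≤ spread Ω u x₀ ((C + 2) * H) t₁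
  · exact Or.inr hsp
  left
  push Not at hsp
  have hν : 0 < θ * ϱ ^ 2 / 2 := by positivity
  obtain ⟨m, hm, hmlt⟩ := exists_lt_of_lt_csSup (⟨0, zero_mem_spreadSet hx₀c hH.le⟩ :
    (spreadSet Ω u x₀ H t').Nonempty)
    (show spread Ω u x₀ H t' - θ * ϱ ^ 2 / 2 < sSup (spreadSet Ω u x₀ H t') by
      unfold spread; linarith)
  obtain ⟨ι, _, w, X, hcard, hw, hsum, hX, hx, hu, hmX⟩ := exists_weights_of_mem_spreadSet hm
  have hu0 : u x₀ t' ≤ u x₀ tf := hreg.mono x₀ hx₀c t' ht'I tf htf ht'f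
  obtain ⟨j, hj, hjv⟩ := exists_weight_ge (v := fun i => u (X i) t') hN0 hε0
    (by rw [hN]; exact_mod_cast hcard) hw hsum (fun i => hnonneg _ (hX i) t' ht'I)
    (by linarith)
  rw [← hθ] at hj
  have hmono : ∀ i, u (X i) t₁ ≤ u (X i) t' := fun i => hreg.mono _ (hX i) t₁ ht₁I t' ht'I htt
  have hjens : u x₀ t₁ ≤ ∑ i, w i * u (X i) t₁ := by
    have := (hreg.conv t₁ ht₁I).map_sum_le (t := Finset.univ) (w := w) (p := X) (fun i _ => hw i)
      hsum (fun i _ => hX i)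
    rw [hx] at this
    simpa using this
  have hjdrop : u (X j) t' - u (X j) t₁ ≤ C * H / 4 := by
    have h1 : w j * (u (X j) t' - u (X j) t₁) ≤ ∑ i, w i * (u (X i) t' - u (X i) t₁) :=
      Finset.single_le_sum (f := fun i => w i * (u (X i) t' - u (X i) t₁))
        (fun i _ => mul_nonneg (hw i) (sub_nonneg.2 (hmono i))) (Finset.mem_univ j)
    simp only [mul_sub, Finset.sum_sub_distrib] at h1
    have h2 : θ * (u (X j) t' - u (X j) t₁) ≤ w j * (u (X j) t' - u (X j) t₁) :=
      mul_le_mul_of_nonneg_right hj (sub_nonneg.2 (hmono j))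
    refine le_of_mul_le_mul_left ?_ hθ0
    have e : θ * (C * H / 4) = 5 * H / 4 := by rw [← hCθ]; ring
    rw [e]
    linarith
  have hsum₁ : ∑ i, w i * u (X i) t₁ + C * H ≤ u x₀ t₁ + (C + 2) * H := by
    have : ∑ i, w i * u (X i) t₁ ≤ ∑ i, w i * u (X i) t' :=
      Finset.sum_le_sum fun i _ => mul_le_mul_of_nonneg_left (hmono i) (hw i)
    linarith
  have hCH : 0 < C * H := by positivity
  have hjball : closedBall (X j) d₀ ⊆ Ω := by
    refine hd₀Ω _ (hX j) (le_trans ?_ hjv)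
    exact hreg.mono _ (hX j) 0 hT0 t' ht'I ht'I.1
  have hXj : X j ∈ Ω := hjball (mem_closedBall_self hd₀.le)
  set Kz := symSection Ω u (C * H) (X j) t₁ with hKz
  have hKzϱ : Kz ⊆ closedBall 0 ϱ := by
    intro η hη
    have h1 := le_spread hb (split_mem_spreadSet hw hsum hX hx hsum₁ hCH.le j hη)
    rw [hmX] at h1
    rw [mem_closedBall, dist_zero_right]
    have h2 : θ * ‖η‖ ^ 2 ≤ w j * ‖η‖ ^ 2 := by gcongr
    have h3 : ‖η‖ ^ 2 ≤ ϱ ^ 2 := le_of_mul_le_mul_left (by linarith) hθ0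
    exact (sq_le_sq₀ (norm_nonneg _) hϱ0.le).1 h3
  have htime := supersolution_time_le hreg hsup hlam hn hb hΩ ht₁ htt ht' hCH hKzϱ hjball hd₀.le
    hϱd hjdrop
  have hKzpos : 0 < detVol Kz := detVol_symSection_pos hreg hb hXj hΩ ht₁I hCH
  have hK₁pos := detVol_symSection_pos hreg hb hx₀ hΩ ht₁I hH
  refine TimeBound.of_height_mul hn hp hlam hH (sub_nonneg.2 htt) hC1 hKzpos hK₁pos hκ0 hκC ?_ htime
  have hscale : ∀ x ∈ Kz, q • x ∈ symSection Ω u H x₀ t₁ := by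
    intro η hη
    have h1 := smul_mem_symSection_of_weights hreg ht₁I hw hsum hX hx hsum₁ hCH.le j hη
    have hwj : 0 < w j := hθ0.trans_le hj
    have h2 := smul_mem_symSection hreg ht₁I hx₀c h1 (c := (C + 2)⁻¹ * (θ / w j))
      ⟨by positivity, mul_le_one₀ (inv_le_one_of_one_le₀ (by linarith)) (by positivity)
        ((div_le_one hwj).2 hj)⟩
    have e : ((C + 2)⁻¹ * (θ / w j)) • w j • η = q • η := by
      rw [smul_smul, hq]; congr 1; field_simp
    rw [e] at h2
    refine symSection_mono ?_ _ _ h2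
    have : (C + 2)⁻¹ * (θ / w j) * ((C + 2) * H) = θ / w j * H := by field_simp
    rw [this]
    exact mul_le_of_le_one_left hH.le ((div_le_one hwj).2 hj)
  have hqβ : q • β ∈ symSection Ω u H x₀ t₁ :=
    symSection_mono (mul_le_of_le_one_left hH.le hq1) _ _ (smul_mem_symSection hreg ht₁I hx₀c hβ ⟨hq0.le, hq1⟩)
  have hfar := detVol_le_of_far_point (isCompact_symSection hreg hb _ ht₁I)
    ⟨0, zero_mem_symSection (hX j) hCH.le⟩ hKzpos (isCompact_symSection hreg hb _ ht₁I) hq0.le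
    hKzϱ hscale hqβ hβ₀0.le hβn
  have : q ^ n * β₀ * detVol Kz ≤ q ^ n * β₀ * (κ * detVol (symSection Ω u H x₀ t₁)) := by
    refine hfar.trans ?_
    have := mul_le_mul_of_nonneg_right hϱκ hK₁pos.le
    linarith
  exact le_of_mul_le_mul_left this (by positivity)

/-- The constant in the comparison of volumes of sections at two times. -/
def volConst (n : ℕ) (p lam Lam : ℝ) : ℝ :=
  Real.sqrt ((96 * Lam / lam) ^ (1 / p) * ((dilation n ^ 2 / 16) ^ n *
    (131 / 2 / frameConst n) ^ 2))

lemma volConst_pos (hn : 1 ≤ n) {p lam Lam : ℝ} (hlam : 0 < lam) (hLam : 0 < Lam) :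
    0 < volConst n p lam Lam := by
  have := dilation_pos hn
  have := frameConst_pos hn
  exact Real.sqrt_pos.2 (by positivity)

/-- The time scale on which a nearly linear gap persists is incompatible with the supersolution
property unless the volume of the section has grown. -/
lemma TimeBound.volume_le {p lam Lam H V V₁ δ τ : ℝ} (hn : 1 ≤ n) (hp : 0 < p) (hlam : 0 < lam)
    (hLam : 0 < Lam) (hH : 0 < H) (hV : 0 < V) (hV₁ : 0 < V₁) (hδ : 0 < δ)
    (hτ : 2 * Lam * ((3 / 8 * H) ^ n * (131 * δ / 2 / (frameConst n * V)) ^ 2) ^ p * τ = H / 32)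
    (h : TimeBound n lam p H V₁ τ) : V ≤ volConst n p lam Lam * δ * V₁ := by
  have hρ := dilation_pos hn
  have hc := frameConst_pos hn
  unfold TimeBound at h
  set X := (3 / 8 * H) ^ n * (131 * δ / 2 / (frameConst n * V)) ^ 2 with hX
  set Y := (6 * H / dilation n ^ 2) ^ n * (V₁ ^ 2)⁻¹ with hY
  have hX0 : 0 < X := by positivity
  have hY0 : 0 < Y := by positivity
  have hXp : 0 < X ^ p := Real.rpow_pos_of_pos hX0 p
  have h1 : Y ^ p ≤ 96 * Lam / lam * X ^ p := by
    have e : H = 64 * Lam * X ^ p * τ := by linarith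
    have hτ0 : 0 < τ := by
      by_contra hneg
      push Not at hneg
      have := mul_nonneg (mul_pos (by positivity : (0:ℝ) < 64 * Lam) hXp).le (neg_nonneg.2 hneg)
      linarith
    have h2 : τ * (lam * Y ^ p) ≤ τ * (96 * (Lam * X ^ p)) := by
      calc _ ≤ 3 / 2 * H := h
        _ = _ := by rw [e]; ring
    have h3 := le_of_mul_le_mul_left h2 hτ0
    rw [div_mul_eq_mul_div, le_div_iff₀ hlam]
    linarith
  set Z := (96 * Lam / lam) ^ (1 / p) with hZ
  have hZ0 : 0 < Z := Real.rpow_pos_of_pos (by positivity) _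
  have h2 : Y ≤ Z * X := by
    have e : (Z * X) ^ p = 96 * Lam / lam * X ^ p := by
      rw [Real.mul_rpow hZ0.le hX0.le, hZ, ← Real.rpow_mul (by positivity),
        one_div_mul_cancel hp.ne', Real.rpow_one]
    rw [← e] at h1
    exact (Real.rpow_le_rpow_iff hY0.le (by positivity) hp).1 h1
  have h3 : V ^ 2 ≤ (Z * ((dilation n ^ 2 / 16) ^ n * (131 / 2 / frameConst n) ^ 2)) *
      δ ^ 2 * V₁ ^ 2 := by
    have hXe : X = (3 / 8 * H) ^ n * ((131 / 2 / frameConst n) ^ 2 * δ ^ 2) * (V ^ 2)⁻¹ := by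
      rw [hX]; field_simp
    have hYe : (3 / 8 * H) ^ n = (6 * H / dilation n ^ 2) ^ n * (dilation n ^ 2 / 16) ^ n := by
      rw [← mul_pow]; congr 1; field_simp; norm_num
    rw [hXe, hYe, hY] at h2
    have hP : 0 < (6 * H / dilation n ^ 2) ^ n := by positivity
    have h4 : (V₁ ^ 2)⁻¹ ≤ Z * ((dilation n ^ 2 / 16) ^ n *
        ((131 / 2 / frameConst n) ^ 2 * δ ^ 2) * (V ^ 2)⁻¹) := by
      refine le_of_mul_le_mul_left (h2.trans_eq ?_) hP
      ring
    have h5 := mul_le_mul_of_nonneg_left h4 (by positivity : 0 ≤ V ^ 2 * V₁ ^ 2)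
    have e1 : V ^ 2 * V₁ ^ 2 * (V₁ ^ 2)⁻¹ = V ^ 2 := by field_simp
    have e2 : V ^ 2 * V₁ ^ 2 * (Z * ((dilation n ^ 2 / 16) ^ n *
        ((131 / 2 / frameConst n) ^ 2 * δ ^ 2) * (V ^ 2)⁻¹)) =
        (Z * ((dilation n ^ 2 / 16) ^ n * (131 / 2 / frameConst n) ^ 2)) * δ ^ 2 * V₁ ^ 2 := by
      field_simp
    rwa [e1, e2] at h5
  have hvol : volConst n p lam Lam ^ 2 =
      Z * ((dilation n ^ 2 / 16) ^ n * (131 / 2 / frameConst n) ^ 2) :=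
    Real.sq_sqrt (by positivity)
  rw [← hvol, ← mul_pow, ← mul_pow] at h3
  have := volConst_pos hn (p := p) hlam hLam
  exact (sq_le_sq₀ hV.le (by positivity)).1 h3

/-- If the gap is nearly linear between `η` and `2η` at time `t'`, then at some earlier time it has
not decreased much while either the volume of the section or the spread has increased. -/
lemma exists_earlier_time {Ω : Set (E n)} {T lam Lam p : ℝ} {u : E n → ℝ → ℝ}
    (hreg : ParabolicRegular Ω 0 T u) (hsub : ViscSubsolution Lam p Ω 0 T u)
    (hlam : 0 < lam) (hLam : 0 < Lam)
    (hp : 0 < p) (hn : 1 ≤ n) (hb : Bornology.IsBounded Ω) (hΩ : IsOpen Ω) (hc : Convex ℝ Ω)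
    {x₀ η : E n} {t' tf δ Q ν H₀ : ℝ} (hx₀ : x₀ ∈ Ω) (ht0 : 0 ≤ t') (ht'f : t' ≤ tf)
    (ht' : t' ≤ T)
    (hdich : ∀ H t₁ t', 0 < H → H ≤ H₀ → 0 ≤ t₁ → t₁ ≤ t' →
      t' ≤ tf → u x₀ t' - u x₀ t₁ ≤ H / 4 →
      TimeBound n lam p H (detVol (symSection Ω u H x₀ t₁)) (t' - t₁) ∨
        spread Ω u x₀ H t' + ν ≤ spread Ω u x₀ (Q * H) t₁)
    (hδ : 0 < δ) (hδ1 : 131 * δ ≤ 1) (h2p : x₀ + (2 : ℝ) • η ∈ closure Ω)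
    (h2m : x₀ - (2 : ℝ) • η ∈ closure Ω) (hg : 0 < midGap u x₀ t' η)
    (hg0 : midGap u x₀ 0 η ≤ 0)
    (hlin : midGap u x₀ t' ((2 : ℝ) • η) ≤ 2 * (1 + δ) * midGap u x₀ t' η)
    {H : ℝ} (hH : H = 128 * δ * midGap u x₀ t' η) (hHH : H ≤ H₀) :
    ∃ t₁, 0 ≤ t₁ ∧ t₁ ≤ t' ∧ (1 - 16 * δ) * midGap u x₀ t' η ≤ midGap u x₀ t₁ η ∧
      u x₀ t' - u x₀ t₁ ≤ H / 4 ∧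
      (detVol (symSection Ω u H x₀ t') ≤
          volConst n p lam Lam * δ * detVol (symSection Ω u H x₀ t₁) ∨
        spread Ω u x₀ H t' + ν ≤ spread Ω u x₀ (Q * H) t₁) := by
  have hc0 := frameConst_pos hn
  have hH0 : 0 < H := by rw [hH]; positivity
  have hV := detVol_symSection_pos hreg hb hx₀ hΩ ⟨ht0, ht'⟩ hH0
  set V := detVol (symSection Ω u H x₀ t') with hVdef
  set r := 2 * Lam * ((3 / 8 * H) ^ n * (131 * δ / 2 / (frameConst n * V)) ^ 2) ^ p with hr
  have hr0 : 0 < r := by positivity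
  have key : ∀ t₁, 0 ≤ t₁ → t₁ ≤ t' → r * (t' - t₁) ≤ H / 32 →
      (1 - 16 * δ) * midGap u x₀ t' η ≤ midGap u x₀ t₁ η ∧ u x₀ t' - u x₀ t₁ ≤ H / 4 := by
    intro t₁ h0 h1 h2
    have := midGap_persists hreg hsub hLam hp hn hb hΩ hc hx₀ h0 h1 ht' hδ hδ1 h2p h2m hg hlin
      (by rw [← hH]; exact h2)
    rwa [← hH] at this
  set τ := H / 32 / r with hτ
  have hτ0 : 0 < τ := by positivity
  have hrτ : r * τ = H / 32 := by rw [hτ]; field_simp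
  rcases lt_or_ge t' τ with hlt | hge
  · exfalso
    have h1 := (key 0 le_rfl ht0 (by rw [sub_zero, ← hrτ]; gcongr)).1
    nlinarith
  · obtain ⟨k1, k2⟩ := key (t' - τ) (by linarith) (by linarith) (by
      rw [sub_sub_cancel, hrτ])
    refine ⟨t' - τ, by linarith, by linarith, k1, k2, ?_⟩
    refine (hdich H (t' - τ) t' hH0 hHH (by linarith) (by linarith) ht'f k2).imp_left fun h => ?_
    rw [sub_sub_cancel] at h
    exact h.volume_le hn hp hlam hLam hH0 hV
      (detVol_symSection_pos hreg hb hx₀ hΩ ⟨by linarith, by linarith⟩ hH0) hδ hrτ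

lemma detVol_mono {K K' : Set (E n)} (hK : IsCompact K) (hne : K.Nonempty) (hK' : IsCompact K')
    (h : K ⊆ K') : detVol K ≤ detVol K' := by
  have := detVol_le_of_smul_mem hK hne hK' zero_le_one (fun x hx => by simpa using h hx)
  simpa using this

/-- A bound at scales comparable to one propagates to all scales if every value is dominated by a
value at a definitely larger scale. -/
lemma forall_le_of_larger_scale {Φ : ℝ → ℝ → ℝ} {s₀ M A : ℝ} {I : Set ℝ} (hs₀ : 0 < s₀)
    (hM : 2 ≤ M) (hbase : ∀ s, s₀ / M ≤ s → s ≤ s₀ → ∀ t ∈ I, Φ s t ≤ A)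
    (hstep : ∀ s, 0 < s → s ≤ s₀ / M → ∀ t ∈ I, Φ s t ≤ A ∨
      ∃ a ∈ Icc 2 M, ∃ t₁ ∈ I, Φ s t ≤ Φ (a * s) t₁) :
    ∀ s, 0 < s → s ≤ s₀ → ∀ t ∈ I, Φ s t ≤ A := by
  have hM0 : 0 < M := by linarith
  have key : ∀ k : ℕ, ∀ s, s₀ / M / 2 ^ k ≤ s → s ≤ s₀ → ∀ t ∈ I, Φ s t ≤ A := by
    intro k
    induction k with
    | zero => intro s h1 h2; exact hbase s (by simpa using h1) h2
    | succ k ih =>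
      intro s h1 h2 t ht
      have hs : 0 < s := lt_of_lt_of_le (by positivity) h1
      rcases le_total (s₀ / M) s with h | h
      · exact hbase s h h2 t ht
      · rcases hstep s hs h t ht with h3 | ⟨a, ha, t₁, ht₁, h3⟩
        · exact h3
        · refine h3.trans (ih _ ?_ ?_ t₁ ht₁)
          · have e : s₀ / M / 2 ^ k = 2 * (s₀ / M / 2 ^ (k + 1)) := by
              rw [pow_succ]; field_simp
            rw [e]
            exact mul_le_mul ha.1 h1 (by positivity) (by linarith [ha.1])
          · rw [le_div_iff₀ hM0] at h
            nlinarith [ha.2]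
  intro s hs hss t ht
  obtain ⟨k, hk⟩ := exists_nat_gt (s₀ / M / s)
  refine key k s ?_ hss t ht
  have h2 : (k : ℝ) < 2 ^ k := by exact_mod_cast k.lt_two_pow_self
  rw [div_le_iff₀ (by positivity)]
  rw [div_lt_iff₀ hs] at hk
  nlinarith

lemma scaled_product_le {G G' s a c k ω ω' γ Γ S S' σ δ : ℝ} (hs : 0 < s) (ha : 0 < a)
    (hc : 0 < c) (hk : 0 < k) (hω : 0 ≤ ω) (hω' : 0 ≤ ω') (hγ : 0 ≤ γ) (hΓ : 0 ≤ Γ)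
    (hG0 : 0 ≤ G) (hG : c * a * G ≤ G') (hωk : ω ≤ k * ω') (hS : S + σ ≤ S')
    (hpar : a ^ δ * k ^ γ ≤ c * Real.exp (Γ * σ)) :
    G * s ^ (-(1 + δ)) * ω ^ γ * Real.exp (Γ * S) ≤
      G' * (a * s) ^ (-(1 + δ)) * ω' ^ γ * Real.exp (Γ * S') := by
  have h1 : ω ^ γ ≤ k ^ γ * ω' ^ γ := by
    rw [← Real.mul_rpow hk.le hω']
    exact Real.rpow_le_rpow hω hωk hγ
  have h2 : Real.exp (Γ * S) * Real.exp (Γ * σ) ≤ Real.exp (Γ * S') := by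
    rw [← Real.exp_add, Real.exp_le_exp]
    nlinarith
  have e1 : (a * s) ^ (-(1 + δ)) = (a * a ^ δ)⁻¹ * s ^ (-(1 + δ)) := by
    rw [Real.mul_rpow ha.le hs.le, Real.rpow_neg ha.le, Real.rpow_add ha, Real.rpow_one]
  have hsp : 0 < s ^ (-(1 + δ)) := Real.rpow_pos_of_pos hs _
  have hap : 0 < a ^ δ := Real.rpow_pos_of_pos ha _
  have hkp : 0 < k ^ γ := Real.rpow_pos_of_pos hk _
  have hωp : 0 ≤ ω' ^ γ := Real.rpow_nonneg hω' _
  have hex := Real.exp_pos (Γ * σ)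
  rw [e1]
  calc G * s ^ (-(1 + δ)) * ω ^ γ * Real.exp (Γ * S)
      ≤ G * s ^ (-(1 + δ)) * (k ^ γ * ω' ^ γ) * Real.exp (Γ * S) := by gcongr
    _ = (a * a ^ δ)⁻¹ * s ^ (-(1 + δ)) * ω' ^ γ * (a * G) * Real.exp (Γ * S) *
        (a ^ δ * k ^ γ) := by field_simp
    _ ≤ (a * a ^ δ)⁻¹ * s ^ (-(1 + δ)) * ω' ^ γ * (a * G) * Real.exp (Γ * S) *
        (c * Real.exp (Γ * σ)) := by gcongr
    _ = (c * a * G) * ((a * a ^ δ)⁻¹ * s ^ (-(1 + δ))) * ω' ^ γ *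
        (Real.exp (Γ * S) * Real.exp (Γ * σ)) := by ring
    _ ≤ _ := by
      have := hG.trans' (by positivity : 0 ≤ c * a * G)
      gcongr

/-- The weighted gap which is increased, at a larger scale and an earlier time, by every nearly
linear scale. -/
def potential (Ω : Set (E n)) (u : E n → ℝ → ℝ) (x₀ e : E n) (δ γ Γ s t : ℝ) : ℝ :=
  midGap u x₀ t (s • e) * s ^ (-(1 + δ)) *
    detVol (symSection Ω u (128 * δ * midGap u x₀ t (s • e)) x₀ t) ^ γ *
    Real.exp (Γ * spread Ω u x₀ (128 * δ * midGap u x₀ t (s • e)) t)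

lemma mul_midGap_le {Ω : Set (E n)} {T : ℝ} {u : E n → ℝ → ℝ}
    (hreg : ParabolicRegular Ω 0 T u) {x₀ e : E n} {s a t : ℝ} (ht : t ∈ Icc 0 T)
    (hx₀ : x₀ ∈ closure Ω) (ha : 1 ≤ a) (h1 : x₀ + (a * s) • e ∈ closure Ω)
    (h2 : x₀ - (a * s) • e ∈ closure Ω) :
    a * midGap u x₀ t (s • e) ≤ midGap u x₀ t ((a * s) • e) := by
  have ha0 : 0 < a := by linarith
  have := (midGap_smul_le hreg ht hx₀ h1 h2 (c := a⁻¹) ⟨by positivity, inv_le_one_of_one_le₀ ha⟩).2.2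
  rw [smul_smul, inv_mul_cancel_left₀ ha0.ne'] at this
  rw [← div_eq_inv_mul, le_div_iff₀ ha0] at this
  linarith

lemma exists_larger_scale {Ω : Set (E n)} {T lam Lam p : ℝ} {u : E n → ℝ → ℝ}
    (hreg : ParabolicRegular Ω 0 T u) (hsub : ViscSubsolution Lam p Ω 0 T u)
    (hlam : 0 < lam) (hLam : 0 < Lam)
    (hp : 0 < p) (hn : 1 ≤ n) (hb : Bornology.IsBounded Ω) (hΩ : IsOpen Ω) (hc : Convex ℝ Ω)
    {x₀ e : E n} {s t' tf δ γ Γ Q M ν H₀ : ℝ} (hx₀ : x₀ ∈ Ω) (ht0 : 0 ≤ t') (ht'f : t' ≤ tf)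
    (ht' : t' ≤ T)
    (hdich : ∀ H t₁ t', 0 < H → H ≤ H₀ → 0 ≤ t₁ → t₁ ≤ t' →
      t' ≤ tf → u x₀ t' - u x₀ t₁ ≤ H / 4 →
      TimeBound n lam p H (detVol (symSection Ω u H x₀ t₁)) (t' - t₁) ∨
        spread Ω u x₀ H t' + ν ≤ spread Ω u x₀ (Q * H) t₁)
    (hδ : 0 < δ) (hδ1 : 131 * δ ≤ 1) (hs : 0 < s)
    (hseg : ∀ a ∈ Icc 1 M, x₀ + (a * s) • e ∈ closure Ω ∧ x₀ - (a * s) • e ∈ closure Ω)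
    (hg0 : midGap u x₀ 0 (s • e) ≤ 0)
    (hHH : 128 * δ * midGap u x₀ t' (s • e) ≤ H₀)
    (hQ : 2 ≤ Q) (hM : 2 * Q ≤ M) (hγ : 0 ≤ γ) (hΓ : 0 ≤ Γ)
    (hpar₀ : (2:ℝ) ^ δ ≤ 1 + δ)
    (hpar₁ : (2:ℝ) ^ δ * (volConst n p lam Lam * δ) ^ γ ≤ 1 - 16 * δ)
    (hpar₂ : M ^ δ ≤ (1 - 16 * δ) * Real.exp (Γ * ν)) :
    potential Ω u x₀ e δ γ Γ s t' ≤ 0 ∨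
      ∃ a ∈ Icc 2 M, ∃ t₁ ∈ Icc 0 tf,
        potential Ω u x₀ e δ γ Γ s t' ≤ potential Ω u x₀ e δ γ Γ (a * s) t₁ := by
  have hx₀c := subset_closure hx₀
  have hM2 : 2 ≤ M := by linarith
  have ht'I : t' ∈ Icc 0 T := ⟨ht0, ht'⟩
  set g := midGap u x₀ t' (s • e) with hg
  set H := 128 * δ * g with hH
  have hCδ : 0 < volConst n p lam Lam * δ := mul_pos (volConst_pos hn hlam hLam) hδ
  rcases le_or_gt g 0 with hgneg | hgpos
  · left
    unfold potential
    rw [← hg]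
    refine mul_nonpos_of_nonpos_of_nonneg (mul_nonpos_of_nonpos_of_nonneg
      (mul_nonpos_of_nonpos_of_nonneg hgneg (Real.rpow_nonneg hs.le _))
      (Real.rpow_nonneg (detVol_nonneg _) _)) (Real.exp_nonneg _)
  right
  have hH0 : 0 < H := by positivity
  have hscale : ∀ t ∈ Icc 0 T, ∀ a ∈ Icc 1 M,
      a * midGap u x₀ t (s • e) ≤ midGap u x₀ t ((a * s) • e) := fun t ht a ha =>
    mul_midGap_le hreg ht hx₀c ha.1 (hseg a ha).1 (hseg a ha).2
  have hVmono : ∀ t ∈ Icc 0 T, ∀ H₁ H₂, 0 ≤ H₁ → H₁ ≤ H₂ →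
      detVol (symSection Ω u H₁ x₀ t) ≤ detVol (symSection Ω u H₂ x₀ t) :=
    fun t ht H₁ H₂ h0 h => detVol_mono (isCompact_symSection hreg hb _ ht)
      ⟨0, zero_mem_symSection hx₀c h0⟩ (isCompact_symSection hreg hb _ ht) (symSection_mono h _ _)
  have h2I : (2:ℝ) ∈ Icc 1 M := ⟨by norm_num, hM2⟩
  have hMI : M ∈ Icc 1 M := ⟨by linarith, le_rfl⟩
  by_cases hlin : midGap u x₀ t' ((2 * s) • e) ≤ 2 * (1 + δ) * g
  · have hex := exists_earlier_time hreg hsub hlam hLam hp hn hb hΩ hc (η := s • e) hx₀ ht0 ht'f ht'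
      hdich hδ hδ1 (by rw [smul_smul]; exact (hseg 2 h2I).1)
      (by rw [smul_smul]; exact (hseg 2 h2I).2) hgpos hg0 (by rw [smul_smul]; exact hlin) hH hHH
    obtain ⟨t₁, h0, h1, hgap, hdrop, hor⟩ := hex
    have ht₁I : t₁ ∈ Icc 0 T := ⟨h0, h1.trans ht'⟩
    have hc5 : (5:ℝ) / 8 ≤ 1 - 16 * δ := by linarith
    rw [← hg] at hgap
    have hup : ∀ a ∈ Icc 1 M, (1 - 16 * δ) * a * g ≤ midGap u x₀ t₁ ((a * s) • e) := by
      intro a ha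
      have h3 := hscale t₁ ht₁I a ha
      have := mul_le_mul_of_nonneg_left hgap (by linarith [ha.1] : (0:ℝ) ≤ a)
      linarith
    have hupH : ∀ a ∈ Icc 1 M, 5 / 8 * a * H ≤ 128 * δ * midGap u x₀ t₁ ((a * s) • e) := by
      intro a ha
      have h3 := hup a ha
      have h4 : 5 / 8 * (a * g) ≤ (1 - 16 * δ) * (a * g) :=
        mul_le_mul_of_nonneg_right hc5 (mul_nonneg (by linarith [ha.1]) hgpos.le)
      have := mul_le_mul_of_nonneg_left (h4.trans (by linarith)) (by positivity : 0 ≤ 128 * δ)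
        (c := midGap u x₀ t₁ ((a * s) • e))
      rw [hH]
      linarith
    rcases hor with hvol | hsp
    · refine ⟨2, ⟨le_rfl, hM2⟩, t₁, ⟨h0, h1.trans ht'f⟩, ?_⟩
      have hH2 := hupH 2 h2I
      unfold potential
      refine scaled_product_le (c := 1 - 16 * δ) (k := volConst n p lam Lam * δ) (σ := 0) hs
        (by norm_num) (by linarith) hCδ (detVol_nonneg _) (detVol_nonneg _) hγ hΓ hgpos.le
        (hup 2 h2I) (hvol.trans ?_) ?_ (by simpa using hpar₁)
      · exact mul_le_mul_of_nonneg_left (hVmono t₁ ht₁I _ _ hH0.le (by linarith)) hCδ.le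
      · rw [add_zero]
        exact spread_le_spread hb hreg hx₀c h0 h1 ht' hH0.le (by linarith)
    · refine ⟨M, ⟨hM2, le_rfl⟩, t₁, ⟨h0, h1.trans ht'f⟩, ?_⟩
      have hHM := hupH M hMI
      have hMQ : Q * H ≤ 5 / 8 * M * H :=
        mul_le_mul_of_nonneg_right (by linarith) hH0.le
      have h2Q : 2 * H ≤ Q * H := mul_le_mul_of_nonneg_right hQ hH0.le
      unfold potential
      refine scaled_product_le (c := 1 - 16 * δ) (k := 1) (σ := ν) hs
        (by linarith) (by linarith) one_pos (detVol_nonneg _) (detVol_nonneg _) hγ hΓ hgpos.le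
        (hup M hMI) ?_ (hsp.trans ?_) (by simpa using hpar₂)
      · rw [one_mul]
        refine detVol_mono (isCompact_symSection hreg hb _ ht'I)
          ⟨0, zero_mem_symSection hx₀c hH0.le⟩ (isCompact_symSection hreg hb _ ht₁I) ?_
        rintro η ⟨k1, k2, k3⟩
        refine ⟨k1, k2, ?_⟩
        have m1 := hreg.mono _ k1 t₁ ht₁I t' ht'I h1
        have m2 := hreg.mono _ k2 t₁ ht₁I t' ht'I h1
        have : midGap u x₀ t₁ η ≤ midGap u x₀ t' η + H / 4 := by
          simp only [midGap]; linarith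
        linarith
      · exact spread_le_spread hb hreg hx₀c h0 le_rfl ht₁I.2 (by linarith) (by linarith)
  · push Not at hlin
    have hmon : g ≤ midGap u x₀ t' ((2 * s) • e) := by nlinarith
    have hHm : H ≤ 128 * δ * midGap u x₀ t' ((2 * s) • e) :=
      mul_le_mul_of_nonneg_left hmon (by positivity)
    refine ⟨2, ⟨le_rfl, hM2⟩, t', ⟨ht0, ht'f⟩, ?_⟩
    unfold potential
    refine scaled_product_le (c := 1 + δ) (k := 1) (σ := 0) hs
      (by norm_num) (by linarith) one_pos (detVol_nonneg _) (detVol_nonneg _) hγ hΓ hgpos.le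
      (by linarith) ?_ ?_ (by simpa using hpar₀)
    · rw [one_mul]; exact hVmono t' ht'I _ _ hH0.le hHm
    · rw [add_zero]
      exact spread_le_spread hb hreg hx₀c ht0 le_rfl ht' hH0.le (by linarith)

/-- The small parameter from which the Hölder exponent is computed. -/
def smallParam (n : ℕ) (p lam Lam : ℝ) : ℝ :=
  min (1 / 200) (Real.exp (-(68 * n)) / volConst n p lam Lam)

lemma smallParam_pos (hn : 1 ≤ n) {p lam Lam : ℝ} (hlam : 0 < lam) (hLam : 0 < Lam) :
    0 < smallParam n p lam Lam :=
  lt_min (by norm_num) (div_pos (Real.exp_pos _) (volConst_pos hn hlam hLam))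

lemma two_rpow_le_one_add {δ : ℝ} (h0 : 0 ≤ δ) (h1 : δ ≤ 1) : (2:ℝ) ^ δ ≤ 1 + δ := by
  have := rpow_one_add_le_one_add_mul_self (s := 1) (by norm_num) h0 h1
  norm_num at this
  exact this

lemma smallParam_spec (hn : 1 ≤ n) {p lam Lam : ℝ} (hlam : 0 < lam) (hLam : 0 < Lam) {δ : ℝ}
    (hδ : δ = smallParam n p lam Lam) :
    (2:ℝ) ^ δ * (volConst n p lam Lam * δ) ^ (δ / (2 * n)) ≤ 1 - 16 * δ := by
  have hn' : (0:ℝ) < n := by exact_mod_cast hn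
  have hδ0 : 0 < δ := hδ ▸ smallParam_pos hn hlam hLam
  have hδ1 : δ ≤ 1 / 200 := hδ ▸ min_le_left _ _
  have hC := volConst_pos hn (p := p) hlam hLam
  have h2 : volConst n p lam Lam * δ ≤ Real.exp (-(68 * n)) := by
    have : δ ≤ Real.exp (-(68 * n)) / volConst n p lam Lam := hδ ▸ min_le_right _ _
    rw [le_div_iff₀ hC] at this
    linarith
  have h3 : (volConst n p lam Lam * δ) ^ (δ / (2 * n)) ≤ Real.exp (-(34 * δ)) := by
    refine (Real.rpow_le_rpow (by positivity) h2 (by positivity)).trans_eq ?_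
    rw [← Real.exp_mul]
    congr 1
    field_simp
    norm_num
  have h4 : (2:ℝ) ^ δ ≤ Real.exp δ :=
    (two_rpow_le_one_add hδ0.le (by linarith)).trans (by linarith [Real.add_one_le_exp δ])
  calc (2:ℝ) ^ δ * (volConst n p lam Lam * δ) ^ (δ / (2 * n))
      ≤ Real.exp δ * Real.exp (-(34 * δ)) := by gcongr
    _ = (Real.exp (33 * δ))⁻¹ := by rw [← Real.exp_add, ← Real.exp_neg]; congr 1; ring
    _ ≤ (1 + 33 * δ)⁻¹ := by
        gcongr
        linarith [Real.add_one_le_exp (33 * δ)]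
    _ ≤ 1 - 16 * δ := by
        rw [inv_le_iff_one_le_mul₀ (by positivity)]
        nlinarith

/-- The Hölder exponent. -/
def holderExp (n : ℕ) (p lam Lam : ℝ) : ℝ :=
  smallParam n p lam Lam / (2 + smallParam n p lam Lam)

lemma holderExp_pos (hn : 1 ≤ n) {p lam Lam : ℝ} (hlam : 0 < lam) (hLam : 0 < Lam) :
    0 < holderExp n p lam Lam := by
  have := smallParam_pos hn (p := p) hlam hLam
  unfold holderExp; positivity

lemma exists_solution_le {Ω : Set (E n)} {T : ℝ} {u : E n → ℝ → ℝ}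
    (hreg : ParabolicRegular Ω 0 T u) (hb : Bornology.IsBounded Ω) :
    ∃ B > (0:ℝ), ∀ x ∈ closure Ω, ∀ t ∈ Icc 0 T, u x t ≤ B := by
  obtain ⟨B, hB⟩ := ((hb.isCompact_closure.prod isCompact_Icc).image_of_continuousOn
    hreg.cont).bddAbove
  exact ⟨max B 1, by positivity, fun x hx t ht =>
    (hB ⟨(x, t), ⟨hx, ht⟩, rfl⟩).trans (le_max_left _ _)⟩

/-- The potential is bounded at all scales. -/
lemma exists_potential_le {Ω : Set (E n)} {T lam Lam p : ℝ} {u : E n → ℝ → ℝ}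
    (hreg : ParabolicRegular Ω 0 T u) (hsub : ViscSubsolution Lam p Ω 0 T u)
    (hsup : ViscSupersolution lam p Ω 0 T u)
    (hlam : 0 < lam) (hLam : 0 < Lam)
    (hp : 0 < p) (hn : 1 ≤ n) (hb : Bornology.IsBounded Ω) (hΩ : IsOpen Ω) (hc : Convex ℝ Ω)
    (hnonneg : ∀ x ∈ closure Ω, ∀ t ∈ Icc 0 T, 0 ≤ u x t) (hfr : ∀ x ∈ frontier Ω, 1 ≤ u x 0)
    {x₀ e : E n} {tf r δ : ℝ} (hr : 0 < r) (hx₀ : x₀ ∈ Ω) (htf : tf ∈ Icc 0 T)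
    (hlt : u x₀ tf < 1)
    (hseg : ∀ a, |a| ≤ r → x₀ + a • e ∈ Ω ∧ u (x₀ + a • e) 0 = 0)
    (hδ : δ = smallParam n p lam Lam) :
    ∃ A > (0:ℝ), ∃ Γ ≥ (0:ℝ), ∀ s, 0 < s → s ≤ r →
      potential Ω u x₀ e δ (δ / (2 * n)) Γ s tf ≤ A := by
  have hδ0 : 0 < δ := hδ ▸ smallParam_pos hn hlam hLam
  have hδ1 : δ ≤ 1 / 200 := hδ ▸ min_le_left _ _
  have hx₀c := subset_closure hx₀
  have hsegp : ∀ a, 0 ≤ a → a ≤ r → x₀ + a • e ∈ closure Ω ∧ x₀ - a • e ∈ closure Ω := by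
    intro a h0 h1
    refine ⟨subset_closure (hseg a (by rwa [abs_of_nonneg h0])).1, ?_⟩
    have := (hseg (-a) (by rwa [abs_neg, abs_of_nonneg h0])).1
    rw [neg_smul, ← sub_eq_add_neg] at this
    exact subset_closure this
  obtain ⟨Q, hQ, ν, hν, H₀, hH₀, hdich⟩ :=
    timeBound_or_spread hreg hsup hlam hp hn hb hΩ hnonneg hfr hx₀ htf hlt
  obtain ⟨B, hB, huB⟩ := exists_solution_le hreg hb
  have hGB : ∀ s, 0 ≤ s → s ≤ r → ∀ t ∈ Icc 0 T, midGap u x₀ t (s • e) ≤ B := by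
    intro s h0 h1 t ht
    have h2 := hsegp s h0 h1
    have := huB _ h2.1 t ht
    have := huB _ h2.2 t ht
    have := hnonneg _ hx₀c t ht
    simp only [midGap]
    linarith
  set M := max (2 * Q) (128 * δ * B / H₀) with hM
  have hMQ : 2 * Q ≤ M := le_max_left _ _
  have hM4 : 4 ≤ M := by linarith
  have hM0 : 0 < M := by linarith
  have hMH : 128 * δ * B ≤ M * H₀ := by
    have : 128 * δ * B / H₀ ≤ M := le_max_right _ _
    rwa [div_le_iff₀ hH₀] at this
  have hden : 0 < 1 - 16 * δ := by linarith
  have hMδ : 1 ≤ M ^ δ / (1 - 16 * δ) := by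
    rw [le_div_iff₀ hden]
    have := Real.one_le_rpow (by linarith : 1 ≤ M) hδ0.le
    linarith
  set Γ := Real.log (M ^ δ / (1 - 16 * δ)) / ν with hΓ
  have hΓ0 : 0 ≤ Γ := div_nonneg (Real.log_nonneg hMδ) hν.le
  have hpar₂ : M ^ δ ≤ (1 - 16 * δ) * Real.exp (Γ * ν) := by
    rw [hΓ, div_mul_cancel₀ _ hν.ne', Real.exp_log (by linarith), mul_div_cancel₀ _ hden.ne']
  obtain ⟨D, hD⟩ := exists_spread_le hb u hx₀c
  obtain ⟨R, hR⟩ := hb.closure.subset_closedBall x₀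
  have hVR : ∀ H t, 0 ≤ H → t ∈ Icc 0 T →
      detVol (symSection Ω u H x₀ t) ≤ detVol (closedBall (0 : E n) R) := by
    intro H t hH ht
    refine detVol_mono (isCompact_symSection hreg hb _ ht) ⟨0, zero_mem_symSection hx₀c hH⟩
      (isCompact_closedBall _ _) fun η hη => ?_
    simpa [dist_eq_norm] using hR hη.1
  set γ := δ / (2 * n) with hγ
  have hγ0 : 0 ≤ γ := by positivity
  set V₀ := detVol (closedBall (0 : E n) R) with hV₀
  have hV₀0 : 0 ≤ V₀ := detVol_nonneg _
  set A := B * (r / M) ^ (-(1 + δ)) * V₀ ^ γ * Real.exp (Γ * D) + 1 with hA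
  have hrM : 0 < r / M := by positivity
  have hA0 : 0 < A := by
    have := Real.rpow_nonneg hV₀0 γ
    have := Real.rpow_nonneg hrM.le (-(1 + δ))
    positivity
  refine ⟨A, hA0, Γ, hΓ0, fun s hs hsr => ?_⟩
  refine forall_le_of_larger_scale (Φ := potential Ω u x₀ e δ γ Γ) (I := Icc 0 tf) hr
    (by linarith : 2 ≤ M) ?_ ?_ s hs hsr tf ⟨htf.1, le_rfl⟩
  · intro s h1 h2 t ht
    have hs0 : 0 < s := hrM.trans_le h1
    have htI : t ∈ Icc 0 T := ⟨ht.1, ht.2.trans htf.2⟩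
    have hsg := hsegp s hs0.le h2
    have hG0 := midGap_nonneg hreg htI hsg.1 hsg.2
    have hH0 : 0 ≤ 128 * δ * midGap u x₀ t (s • e) := by positivity
    have h3 : s ^ (-(1 + δ)) ≤ (r / M) ^ (-(1 + δ)) :=
      Real.rpow_le_rpow_of_nonpos hrM h1 (by linarith)
    have h4 : detVol (symSection Ω u (128 * δ * midGap u x₀ t (s • e)) x₀ t) ^ γ ≤ V₀ ^ γ :=
      Real.rpow_le_rpow (detVol_nonneg _) (hVR _ t hH0 htI) hγ0
    have h5 : Real.exp (Γ * spread Ω u x₀ (128 * δ * midGap u x₀ t (s • e)) t) ≤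
        Real.exp (Γ * D) := Real.exp_le_exp.2 (mul_le_mul_of_nonneg_left (hD _ t hH0) hΓ0)
    have h6 := hGB s hs0.le h2 t htI
    have h7 := Real.rpow_nonneg hs0.le (-(1 + δ))
    have h8 := Real.rpow_nonneg
      (detVol_nonneg (symSection Ω u (128 * δ * midGap u x₀ t (s • e)) x₀ t)) γ
    have h9 := Real.rpow_nonneg hV₀0 γ
    have h10 := Real.rpow_nonneg hrM.le (-(1 + δ))
    have : potential Ω u x₀ e δ γ Γ s t ≤ B * (r / M) ^ (-(1 + δ)) * V₀ ^ γ * Real.exp (Γ * D) := by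
      unfold potential
      gcongr
    linarith
  · intro s hs hsM t ht
    rw [le_div_iff₀ hM0] at hsM
    have htI : t ∈ Icc 0 T := ⟨ht.1, ht.2.trans htf.2⟩
    have hsa : ∀ a ∈ Icc 1 M, 0 ≤ a * s ∧ a * s ≤ r := fun a ha =>
      ⟨by nlinarith [ha.1], by nlinarith [ha.2]⟩
    have hMI : M ∈ Icc 1 M := ⟨by linarith, le_rfl⟩
    have hsr : s ≤ r := by nlinarith
    have := exists_larger_scale hreg hsub hlam hLam hp hn hb hΩ hc (e := e) (s := s) (t' := t)
      (tf := tf) (δ := δ) (γ := γ) (Γ := Γ) (Q := Q) (M := M) (ν := ν) (H₀ := H₀) hx₀ ht.1 ht.2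
      htI.2 hdich hδ0 (by linarith) hs (fun a ha => hsegp _ (hsa a ha).1 (hsa a ha).2) ?_ ?_ hQ hMQ
      hγ0 hΓ0 (two_rpow_le_one_add hδ0.le (by linarith)) (smallParam_spec hn hlam hLam hδ) hpar₂
    · exact this.imp_left fun h => h.trans hA0.le
    · have z1 := (hseg s (by rwa [abs_of_pos hs])).2
      have z2 := (hseg (-s) (by rwa [abs_neg, abs_of_pos hs])).2
      rw [neg_smul, ← sub_eq_add_neg] at z2
      have z3 := (hseg 0 (by simpa using hr.le)).2
      rw [zero_smul, add_zero] at z3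
      simp [midGap, z1, z2, z3]
    · have h1 := mul_midGap_le hreg (e := e) (s := s) htI hx₀c hMI.1
        (hsegp _ (hsa M hMI).1 (hsa M hMI).2).1 (hsegp _ (hsa M hMI).1 (hsa M hMI).2).2
      have h2 := h1.trans (hGB _ (hsa M hMI).1 (hsa M hMI).2 t htI)
      refine le_of_mul_le_mul_left ?_ hM0
      have := mul_le_mul_of_nonneg_left h2 (by positivity : 0 ≤ 128 * δ)
      linarith

/-- Power decay of the gap at a point at which the initial datum vanishes along a segment. -/
lemma exists_midGap_le {Ω : Set (E n)} {T lam Lam p : ℝ} {u : E n → ℝ → ℝ}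
    (hreg : ParabolicRegular Ω 0 T u) (hsub : ViscSubsolution Lam p Ω 0 T u)
    (hsup : ViscSupersolution lam p Ω 0 T u)
    (hlam : 0 < lam) (hLam : 0 < Lam)
    (hp : 0 < p) (hn : 1 ≤ n) (hb : Bornology.IsBounded Ω) (hΩ : IsOpen Ω) (hc : Convex ℝ Ω)
    (hnonneg : ∀ x ∈ closure Ω, ∀ t ∈ Icc 0 T, 0 ≤ u x t) (hfr : ∀ x ∈ frontier Ω, 1 ≤ u x 0)
    {x₀ e : E n} {tf r : ℝ} (hr : 0 < r) (hx₀ : x₀ ∈ Ω) (htf : tf ∈ Icc 0 T)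
    (hlt : u x₀ tf < 1)
    (hseg : ∀ a, |a| ≤ r → x₀ + a • e ∈ Ω ∧ u (x₀ + a • e) 0 = 0) :
    ∃ A, ∀ s, 0 < s → s ≤ r →
      midGap u x₀ tf (s • e) ≤ A * s ^ (1 + holderExp n p lam Lam) := by
  set δ := smallParam n p lam Lam with hδ
  have hδ0 : 0 < δ := hδ ▸ smallParam_pos hn hlam hLam
  have hn' : (0:ℝ) < n := by exact_mod_cast hn
  have hx₀c := subset_closure hx₀
  obtain ⟨A, hA, Γ, hΓ, hpot⟩ := exists_potential_le hreg hsub hsup hlam hLam hp hn hb hΩ hc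
    hnonneg hfr hr hx₀ htf hlt hseg hδ
  obtain ⟨B, hB, huB⟩ := exists_solution_le hreg hb
  obtain ⟨r₀, hr₀, hball⟩ := exists_closedBall_subset_symSection hreg hx₀ hΩ htf
    (by positivity : 0 < 128 * δ * B)
  set A₁ := A * (B / r₀) ^ (δ / 2) with hA₁
  have hA₁0 : 0 < A₁ := mul_pos hA (Real.rpow_pos_of_pos (by positivity) _)
  refine ⟨A₁ ^ (1 / (1 + δ / 2)), fun s hs hsr => ?_⟩
  have h1 := subset_closure (hseg s (by rwa [abs_of_pos hs])).1
  have h2 := subset_closure (hseg (-s) (by rwa [abs_neg, abs_of_pos hs])).1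
  rw [neg_smul, ← sub_eq_add_neg] at h2
  have hP := hpot s hs hsr
  unfold potential at hP
  set G := midGap u x₀ tf (s • e) with hG
  rcases le_or_gt G 0 with hG0 | hG0
  · exact hG0.trans (mul_nonneg (Real.rpow_nonneg hA₁0.le _) (Real.rpow_nonneg hs.le _))
  have hGB : G ≤ B := by
    have := huB _ h1 tf htf
    have := huB _ h2 tf htf
    have := hnonneg _ hx₀c tf htf
    simp only [hG, midGap]
    linarith
  have hH0 : 0 < 128 * δ * G := by positivity
  have hω : (G / B * r₀) ^ n ≤ detVol (symSection Ω u (128 * δ * G) x₀ tf) := by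
    refine pow_le_detVol (isCompact_symSection hreg hb _ htf) (by positivity) fun η hη => ?_
    rw [mem_closedBall, dist_zero_right] at hη
    have hm : (G / B)⁻¹ • η ∈ closedBall (0 : E n) r₀ := by
      rw [mem_closedBall, dist_zero_right, norm_smul, Real.norm_of_nonneg (by positivity),
        inv_mul_le_iff₀ (by positivity)]
      exact hη
    have := smul_mem_symSection hreg htf hx₀c (hball hm) (c := G / B)
      ⟨by positivity, (div_le_one hB).2 hGB⟩
    rw [smul_inv_smul₀ (by positivity)] at this
    convert this using 2
    field_simp
  have hωγ : (G / B * r₀) ^ (δ / 2) ≤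
      detVol (symSection Ω u (128 * δ * G) x₀ tf) ^ (δ / (2 * n)) := by
    refine Eq.trans_le ?_ (Real.rpow_le_rpow (by positivity) hω (by positivity))
    rw [← Real.rpow_natCast, ← Real.rpow_mul (by positivity)]
    congr 1
    field_simp
  have hexp : 1 ≤ Real.exp (Γ * spread Ω u x₀ (128 * δ * G) tf) :=
    Real.one_le_exp (mul_nonneg hΓ (spread_nonneg hb hx₀c hH0.le))
  have hsp := Real.rpow_pos_of_pos hs (1 + δ)
  have hsn := Real.rpow_pos_of_pos hs (-(1 + δ))
  have hmain : G ^ (1 + δ / 2) ≤ A₁ * s ^ (1 + δ) := by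
    have k1 : G * s ^ (-(1 + δ)) * (G / B * r₀) ^ (δ / 2) ≤ A := by
      refine le_trans ?_ hP
      have hd := (Real.rpow_nonneg (by positivity : 0 ≤ G / B * r₀) (δ / 2)).trans hωγ
      calc G * s ^ (-(1 + δ)) * (G / B * r₀) ^ (δ / 2)
          ≤ G * s ^ (-(1 + δ)) * detVol (symSection Ω u (128 * δ * G) x₀ tf) ^ (δ / (2 * n)) := by
            gcongr
        _ ≤ _ := le_mul_of_one_le_right (by positivity) hexp
    have e1 : G / B * r₀ = G * (B / r₀)⁻¹ := by field_simp
    rw [e1, Real.mul_rpow hG0.le (by positivity), Real.inv_rpow (by positivity),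
      Real.rpow_neg hs.le] at k1
    have hBr : 0 < (B / r₀) ^ (δ / 2) := Real.rpow_pos_of_pos (by positivity) _
    have k2 := mul_le_mul_of_nonneg_right k1 (mul_pos hBr hsp).le
    rw [Real.rpow_add hG0, Real.rpow_one, hA₁]
    calc G * G ^ (δ / 2) = G * (s ^ (1 + δ))⁻¹ * (G ^ (δ / 2) * ((B / r₀) ^ (δ / 2))⁻¹) *
          ((B / r₀) ^ (δ / 2) * s ^ (1 + δ)) := by field_simp
      _ ≤ _ := k2
      _ = _ := by ring
  have hfin := Real.rpow_le_rpow (by positivity) hmain (by positivity : 0 ≤ 1 / (1 + δ / 2))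
  rw [← Real.rpow_mul hG0.le, mul_one_div_cancel (by positivity), Real.rpow_one,
    Real.mul_rpow hA₁0.le hsp.le, ← Real.rpow_mul hs.le] at hfin
  convert hfin using 3
  unfold holderExp
  rw [← hδ]
  field_simp
  ring

/-- A convex function on an open set has a supporting affine function at every point. -/
lemma exists_subgradient {w : E n → ℝ} {D : Set (E n)} (hw : ConvexOn ℝ D w) (hD : IsOpen D)
    {x₀ : E n} (hx₀ : x₀ ∈ D) :
    ∃ φ : E n →L[ℝ] ℝ, ∀ η, x₀ + η ∈ D → φ η ≤ w (x₀ + η) - w x₀ := by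
  have hcont : Continuous fun η : E n => x₀ + η := by fun_prop
  refine exists_linear_le (B := {η | x₀ + η ∈ D}) (W := fun η => w (x₀ + η) - w x₀)
    (hD.preimage hcont) (by simpa) ?_ ?_
  · exact ((hw.continuousOn hD).comp hcont.continuousOn fun η hη => hη).sub continuousOn_const
  · intro ι _ θ η hθ hsum hη hbar
    have := hw.map_sum_le (t := Finset.univ) (w := θ) (p := fun i => x₀ + η i) (fun i _ => hθ i)
      hsum (fun i _ => hη i)
    simp only [smul_add, Finset.sum_add_distrib, ← Finset.sum_smul, hsum, one_smul, hbar, add_zero,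
      smul_eq_mul] at this
    simp only [mul_sub, Finset.sum_sub_distrib, ← Finset.sum_mul, hsum, one_mul]
    linarith

/-- Second difference bounds in the coordinate directions imply `C^{1,α}` regularity of a bounded
convex function. -/
lemma c1AlphaAt_of_coord {w : E n → ℝ} {D : Set (E n)} (hw : ConvexOn ℝ D w) (hD : IsOpen D)
    {x₀ : E n} (hx₀ : x₀ ∈ D) {B α r : ℝ} (hB : ∀ x ∈ D, |w x| ≤ B) (hα : 0 < α) (hr : 0 < r)
    (hmem : ∀ i : Fin n, ∀ s : ℝ, |s| ≤ r → x₀ + s • EuclideanSpace.single i (1:ℝ) ∈ D)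
    (hdiff : ∀ i : Fin n, ∃ A : ℝ, ∀ s, 0 < s → s ≤ r →
      w (x₀ + s • EuclideanSpace.single i (1:ℝ)) + w (x₀ - s • EuclideanSpace.single i (1:ℝ)) -
        2 * w x₀ ≤ A * s ^ (1 + α)) :
    C1AlphaAt w D α x₀ := by
  obtain ⟨φ, hφ⟩ := exists_subgradient hw hD hx₀
  choose A hA using hdiff
  set v : E n → ℝ := fun η => w (x₀ + η) - w x₀ - φ η with hv
  have hv0 : ∀ η, x₀ + η ∈ D → 0 ≤ v η := fun η hη => by
    have := hφ η hη
    simp only [hv]; linarith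
  set A₀ := ∑ i, |A i| with hA₀
  have hA₀0 : 0 ≤ A₀ := Finset.sum_nonneg fun i _ => abs_nonneg _
  have hα1 : 1 + α ≠ 0 := by positivity
  have hcoord : ∀ (i : Fin n) (s : ℝ), |s| ≤ r →
      v (s • EuclideanSpace.single i (1:ℝ)) ≤ A₀ * |s| ^ (1 + α) := by
    have hpos : ∀ (i : Fin n) (s : ℝ), 0 < s → s ≤ r →
        v (s • EuclideanSpace.single i (1:ℝ)) + v (-(s • EuclideanSpace.single i (1:ℝ))) ≤
          A₀ * s ^ (1 + α) := by
      intro i s hs hsr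
      have h1 := hA i s hs hsr
      have h2 : A i * s ^ (1 + α) ≤ A₀ * s ^ (1 + α) :=
        mul_le_mul_of_nonneg_right ((le_abs_self _).trans
          (Finset.single_le_sum (f := fun i => |A i|) (fun i _ => abs_nonneg _)
            (Finset.mem_univ i))) (Real.rpow_nonneg hs.le _)
      simp only [hv, map_neg, ← sub_eq_add_neg]
      linarith
    intro i s hs
    have m1 := hv0 _ (hmem i s hs)
    have m2 := hv0 _ (hmem i (-s) (by rwa [abs_neg]))
    rcases lt_trichotomy s 0 with h | h | h
    · rw [abs_of_neg h] at hs ⊢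
      have := hpos i (-s) (by linarith) hs
      rw [neg_smul, neg_neg] at this
      rw [neg_smul] at m2
      linarith
    · subst h
      simp [hv, Real.zero_rpow hα1]
    · rw [abs_of_pos h] at hs ⊢
      have := hpos i s h hs
      rw [neg_smul] at m2
      linarith
  have hnear : ∀ η, ‖η‖ ≤ r / (n + 1) → x₀ + η ∈ D →
      v η ≤ A₀ * (n : ℝ) ^ (1 + α) * ‖η‖ ^ (1 + α) := by
    intro η hη hηD
    rcases Nat.eq_zero_or_pos n with rfl | hn
    · have : η = 0 := Subsingleton.elim _ _
      subst this
      simp [hv, Real.zero_rpow hα1]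
    have hn' : (0:ℝ) < n := by exact_mod_cast hn
    have hηi : ∀ i, |n * η i| ≤ n * ‖η‖ := fun i => by
      rw [abs_mul, abs_of_pos hn']
      have := PiLp.norm_apply_le η i
      rw [Real.norm_eq_abs] at this
      gcongr
    have hnr : n * ‖η‖ ≤ r := by
      rw [le_div_iff₀ (by positivity)] at hη
      nlinarith [norm_nonneg η]
    have hsum1 : ∑ _i : Fin n, (1 / (n:ℝ)) = 1 := by
      rw [Finset.sum_const, Finset.card_univ, Fintype.card_fin, nsmul_eq_mul]
      field_simp
    have hηe : ∑ i, (1 / (n:ℝ)) • ((n * η i) • EuclideanSpace.single i (1:ℝ)) = η := by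
      ext j
      simp [Pi.single_apply]
      field_simp
    have hj := hw.map_sum_le (t := Finset.univ) (w := fun _ : Fin n => 1 / (n:ℝ))
      (p := fun i => x₀ + (n * η i) • EuclideanSpace.single i (1:ℝ)) (fun i _ => by positivity)
      hsum1 (fun i _ => hmem i _ ((hηi i).trans hnr))
    simp only [smul_add, Finset.sum_add_distrib, hηe, ← Finset.sum_smul, hsum1, one_smul,
      smul_eq_mul] at hj
    have hφe : φ η = ∑ i, (1 / (n:ℝ)) * φ ((n * η i) • EuclideanSpace.single i (1:ℝ)) := by
      conv_lhs => rw [← hηe]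
      simp only [map_sum, map_smul, smul_eq_mul]
    calc v η ≤ ∑ i, (1 / (n:ℝ)) * v ((n * η i) • EuclideanSpace.single i (1:ℝ)) := by
          simp only [hv, mul_sub, Finset.sum_sub_distrib, ← Finset.sum_mul, hsum1, one_mul]
          rw [hφe]
          linarith
      _ ≤ ∑ _i : Fin n, (1 / (n:ℝ)) * (A₀ * (n * ‖η‖) ^ (1 + α)) := by
          gcongr with i
          refine (hcoord i _ ((hηi i).trans hnr)).trans ?_
          have := hηi i
          gcongr
      _ = A₀ * (n : ℝ) ^ (1 + α) * ‖η‖ ^ (1 + α) := by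
          rw [← Finset.sum_mul, hsum1, Real.mul_rpow hn'.le (norm_nonneg _)]; ring
  set ρ := r / (n + 1) with hρ
  have hρ0 : 0 < ρ := by positivity
  have hB0 : 0 ≤ B := (abs_nonneg _).trans (hB x₀ hx₀)
  have hfar : ∀ η, ρ ≤ ‖η‖ → x₀ + η ∈ D →
      v η ≤ (2 * B * (ρ⁻¹) ^ (1 + α) + ‖φ‖ * (ρ⁻¹) ^ α) * ‖η‖ ^ (1 + α) := by
    intro η hη hηD
    have hη0 : 0 < ‖η‖ := hρ0.trans_le hη
    have h1 := abs_le.1 (hB _ hηD)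
    have h2 := abs_le.1 (hB _ hx₀)
    have h3 := abs_le.1 ((Real.norm_eq_abs _).symm.le.trans (φ.le_opNorm η))
    have h4 : 1 ≤ ρ⁻¹ * ‖η‖ := by
      rw [← div_eq_inv_mul, le_div_iff₀ hρ0]; linarith
    have h5 : 1 ≤ (ρ⁻¹) ^ (1 + α) * ‖η‖ ^ (1 + α) := by
      rw [← Real.mul_rpow (by positivity) (by positivity)]
      exact Real.one_le_rpow h4 (by positivity)
    have h6 : ‖η‖ ≤ (ρ⁻¹) ^ α * ‖η‖ ^ (1 + α) := by
      rw [Real.rpow_add hη0, Real.rpow_one, mul_left_comm,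
        ← Real.mul_rpow (by positivity) (by positivity)]
      exact le_mul_of_one_le_right hη0.le (Real.one_le_rpow h4 hα.le)
    have h7 := mul_le_mul_of_nonneg_left h5 (by positivity : 0 ≤ 2 * B)
    have h8 := mul_le_mul_of_nonneg_left h6 (norm_nonneg φ)
    simp only [hv]
    linarith
  set C₁ := A₀ * (n : ℝ) ^ (1 + α) with hC₁
  set C₂ := 2 * B * (ρ⁻¹) ^ (1 + α) + ‖φ‖ * (ρ⁻¹) ^ α with hC₂
  refine ⟨max C₁ C₂, w x₀, (InnerProductSpace.toDual ℝ (E n)).symm φ, fun x hx => ?_⟩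
  rw [InnerProductSpace.toDual_symm_apply]
  have hxe : x₀ + (x - x₀) = x := by abel
  have hxD : x₀ + (x - x₀) ∈ D := by rwa [hxe]
  have hve : w x - (w x₀ + φ (x - x₀)) = v (x - x₀) := by
    simp only [hv, hxe]; ring
  rw [hve, abs_of_nonneg (hv0 _ hxD)]
  have hpw := Real.rpow_nonneg (norm_nonneg (x - x₀)) (1 + α)
  rcases le_total ‖x - x₀‖ ρ with h | h
  · exact (hnear _ h hxD).trans (mul_le_mul_of_nonneg_right (le_max_left _ _) hpw)
  · exact (hfar _ h hxD).trans (mul_le_mul_of_nonneg_right (le_max_right _ _) hpw)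

/-- The embedding of the slice `{xₙ = 0}` as a linear map. -/
def embSliceLinear (n : ℕ) : E (n - 1) →ₗ[ℝ] E n where
  toFun := embSlice n
  map_add' x y := by
    ext i
    by_cases h : (i : ℕ) < n - 1 <;> simp [embSlice, h]
  map_smul' c x := by
    ext i
    by_cases h : (i : ℕ) < n - 1 <;> simp [embSlice, h]

/-- `C^{1,α}` regularity along an affine image of a Euclidean space on which the initial datum
vanishes. -/
lemma c1AlphaAt_comp_linear {m : ℕ} {Ω : Set (E n)} {T lam Lam p : ℝ} {u : E n → ℝ → ℝ}
    (hreg : ParabolicRegular Ω 0 T u) (hsub : ViscSubsolution Lam p Ω 0 T u)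
    (hsup : ViscSupersolution lam p Ω 0 T u)
    (hlam : 0 < lam) (hLam : 0 < Lam)
    (hp : 0 < p) (hn : 1 ≤ n) (hb : Bornology.IsBounded Ω) (hΩ : IsOpen Ω) (hc : Convex ℝ Ω)
    (hnonneg : ∀ x ∈ Ω, 0 ≤ u x 0) (hfr : ∀ x ∈ frontier Ω, 1 ≤ u x 0)
    (L : E m →ₗ[ℝ] E n) {x : E m} {t : ℝ} (ht : t ∈ Icc 0 T)
    (hx : x ∈ interior {y : E m | L y ∈ Ω ∧ u (L y) 0 = 0}) (hlt : u (L x) t < 1) :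
    C1AlphaAt (fun y => u (L y) t) {y | L y ∈ Ω} (holderExp n p lam Lam) x := by
  have hT0 : (0:ℝ) ∈ Icc 0 T := ⟨le_rfl, ht.1.trans ht.2⟩
  have hnonneg' : ∀ x ∈ closure Ω, ∀ t ∈ Icc 0 T, 0 ≤ u x t := by
    intro x hx t ht
    refine le_trans ?_ (hreg.mono x hx 0 hT0 t ht ht.1)
    by_cases hxΩ : x ∈ Ω
    · exact hnonneg x hxΩ
    · exact zero_le_one.trans (hfr x ⟨hx, by rwa [hΩ.interior_eq]⟩)
  obtain ⟨r, hr, hball⟩ := nhds_basis_closedBall.mem_iff.1 (mem_interior_iff_mem_nhds.1 hx)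
  have hxΩ : L x ∈ Ω := (interior_subset hx).1
  obtain ⟨B, hB, huB⟩ := exists_solution_le hreg hb
  have hseg : ∀ (i : Fin m) (s : ℝ), |s| ≤ r →
      L x + s • L (EuclideanSpace.single i (1:ℝ)) ∈ Ω ∧
        u (L x + s • L (EuclideanSpace.single i (1:ℝ))) 0 = 0 := by
    intro i s hs
    have : x + s • EuclideanSpace.single i (1:ℝ) ∈ closedBall x r := by
      rw [mem_closedBall, dist_eq_norm, add_sub_cancel_left, norm_smul]
      simpa using hs
    have h := hball this
    rwa [mem_ofPred_eq, map_add, map_smul] at h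
  refine c1AlphaAt_of_coord (B := B) (r := r) ?_ (hΩ.preimage L.continuous_of_finiteDimensional)
    hxΩ ?_ (holderExp_pos hn hlam hLam) hr ?_ ?_
  · exact ((hreg.conv t ht).subset subset_closure hc).comp_linearMap L
  · intro y hy
    rw [abs_of_nonneg (hnonneg' _ (subset_closure hy) t ht)]
    exact huB _ (subset_closure hy) t ht
  · intro i s hs
    rw [mem_preimage, map_add, map_smul]
    exact (hseg i s hs).1
  · intro i
    obtain ⟨A, hA⟩ := exists_midGap_le hreg hsub hsup hlam hLam hp hn hb hΩ hc hnonneg' hfr hr hxΩ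
      ht hlt (hseg i)
    refine ⟨2 * A, fun s hs hsr => ?_⟩
    have := hA s hs hsr
    simp only [midGap] at this
    simp only [map_add, map_sub, map_smul]
    linarith

/-- Theorem 1.1, `C^{1,α}` regularity at the flat part of the initial data. -/
theorem stmt0 (n : ℕ) (hn : 1 ≤ n) (p lam Lam : ℝ)
    (hp : 0 < p) (hlam : 0 < lam) (hll : lam ≤ Lam) :
    ∃ α : ℝ, 0 < α ∧
      ∀ (Ω : Set (E n)) (T : ℝ) (u : E n → ℝ → ℝ),
        IsOpen Ω → Convex ℝ Ω → Bornology.IsBounded Ω → 0 < T →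
        ViscositySolution lam Lam p Ω 0 T u →
        (∀ x ∈ Ω, 0 ≤ u x 0) →
        (∀ x ∈ frontier Ω, 1 ≤ u x 0) →
        ((∀ t ∈ Ioc 0 T, ∀ x ∈ interior {y ∈ Ω | u y 0 = 0},
            u x t < 1 → C1AlphaAt (fun y => u y t) Ω α x) ∧
         ((∀ x ∈ Ω, |x ⟨n-1, by omega⟩| ≤ u x 0) →
            ∀ t ∈ Ioc 0 T, ∀ x' : E (n-1),
              x' ∈ interior {y' : E (n-1) | embSlice n y' ∈ Ω ∧ u (embSlice n y') 0 = 0} →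
              u (embSlice n x') t < 1 →
              C1AlphaAt (fun y' => u (embSlice n y') t) {y' | embSlice n y' ∈ Ω} α x')) := by
  refine ⟨holderExp n p lam Lam, holderExp_pos hn hlam (hlam.trans_le hll), ?_⟩
  rintro Ω T u hΩ hc hb hT ⟨hreg, hsub, hsup⟩ hnn hfr
  refine ⟨fun t ht x hx hlt => ?_, fun _ t ht x' hx hlt => ?_⟩
  · exact c1AlphaAt_comp_linear hreg hsub hsup hlam (hlam.trans_le hll) hp hn hb hΩ hc hnn hfr
      LinearMap.id (Ioc_subset_Icc_self ht) hx hlt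
  · exact c1AlphaAt_comp_linear hreg hsub hsup hlam (hlam.trans_le hll) hp hn hb hΩ hc hnn hfr
      (embSliceLinear n) (Ioc_subset_Icc_self ht) hx hlt
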